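/- arXiv:2005.01695 — 4 statements merged into one kernel-verified Lean document; each statement's English description precedes it below -/
import Mathlib

section
/- There exists an absolute constant C > 0 such that for every natural number n there exists a set A of natural numbers with |A| = n for which the cosine polynomial f_A(x) = ∑_{a ∈ A} cos(a x) has at most C·(n·log n)^{2/3} zeros in the interval [0, 2π]. -/
open Real MeasureTheory

/-- `zeros f S` : the number of zeros of `f` in the set `S`. -/
noncomputable def zeros (f : ℝ → ℝ) (S : Set ℝ) : ℕ := {x ∈ S | f x = 0}.ncard

lemma Finset.card_le_two_mul_card_add_two {Z W : Finset ℝ}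
    (h : ∀ x ∈ Z, ∀ y ∈ Z, ∀ z ∈ Z, x < y → y < z → ∃ w ∈ W, x ≤ w ∧ w < z) :
    Z.card ≤ 2 * W.card + 2 := by
  classical
  let rank : ℝ → ℕ := fun z => (W.filter (· < z)).card
  have hmaps : ∀ z ∈ Z, rank z ∈ Finset.range (W.card + 1) := fun z _ =>
    Finset.mem_range.2 (Nat.lt_succ_of_le (Finset.card_filter_le _ _))
  have hfib : ∀ r ∈ Finset.range (W.card + 1), (Z.filter fun z => rank z = r).card ≤ 2 := by
    intro r _
    by_contra! hcard
    set F := Z.filter fun z => rank z = r with hF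
    let e := F.orderEmbOfFin rfl
    have hmem : ∀ i, e i ∈ Z ∧ rank (e i) = r := fun i =>
      Finset.mem_filter.1 (F.orderEmbOfFin_mem rfl i)
    let i₀ : Fin F.card := ⟨0, by omega⟩
    let i₁ : Fin F.card := ⟨1, by omega⟩
    let i₂ : Fin F.card := ⟨2, hcard⟩
    obtain ⟨w, hw, h₀, h₂⟩ := h (e i₀) (hmem _).1 (e i₁) (hmem _).1 (e i₂) (hmem _).1
      (e.strictMono (by simp [i₀, i₁])) (e.strictMono (by simp [i₁, i₂]))
    have hlt : rank (e i₀) < rank (e i₂) := by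
      refine Finset.card_lt_card (Finset.ssubset_iff_of_subset ?_ |>.2 ⟨w, ?_, ?_⟩)
      · intro v hv
        simp only [Finset.mem_filter] at hv ⊢
        exact ⟨hv.1, by linarith [hv.2]⟩
      · simp [hw, h₂]
      · simp [h₀]
    rw [(hmem _).2, (hmem _).2] at hlt
    exact lt_irrefl _ hlt
  calc Z.card ≤ 2 * (Finset.range (W.card + 1)).card :=
        Finset.card_le_mul_card_image_of_maps_to hmaps 2 hfib
    _ = 2 * W.card + 2 := by simp; ring

lemma exists_deriv_sq_eq_of_sin_eq {P P' : ℝ → ℝ} {ω x y : ℝ} (hP : ∀ x, HasDerivAt P (P' x) x)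
    (hxy : x < y) (hlt : ∀ c ∈ Set.Icc x y, P c ^ 2 < 1)
    (hcos : ∀ c ∈ Set.Icc x y, cos (ω * c) ≠ 0)
    (hx : sin (ω * x) = P x) (hy : sin (ω * y) = P y) :
    ∃ c ∈ Set.Ioo x y, P' c ^ 2 = ω ^ 2 * (1 - P c ^ 2) := by
  have hder : ∀ c ∈ Set.Icc x y, HasDerivAt (fun t => arcsin (P t) - arcsin (sin (ω * t)))
      (1 / √(1 - P c ^ 2) * P' c - 1 / √(1 - sin (ω * c) ^ 2) * (cos (ω * c) * ω)) c := by
    intro c hc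
    have h1 := abs_lt.1 ((sq_lt_one_iff_abs_lt_one _).1 (hlt c hc))
    have hs : sin (ω * c) ^ 2 < 1 := by
      have := sin_sq_add_cos_sq (ω * c)
      have := pow_pos (abs_pos.2 (hcos c hc)) 2
      rw [sq_abs] at this
      linarith
    have h2 := abs_lt.1 ((sq_lt_one_iff_abs_lt_one _).1 hs)
    have hsin : HasDerivAt (fun t => sin (ω * t)) (cos (ω * c) * ω) c := by
      simpa using ((hasDerivAt_id c).const_mul ω).sin
    have hsin' := (hasDerivAt_arcsin h2.1.ne' h2.2.ne).comp (h := fun t => sin (ω * t)) c hsin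
    exact ((hasDerivAt_arcsin h1.1.ne' h1.2.ne).comp c (hP c)).sub hsin'
  obtain ⟨c, hc, hc0⟩ := exists_hasDerivAt_eq_zero hxy
    (fun c hc => (hder c hc).continuousAt.continuousWithinAt) (by simp [hx, hy])
    (fun c hc => hder c (Set.Ioo_subset_Icc_self hc))
  refine ⟨c, hc, ?_⟩
  have hc' := Set.Ioo_subset_Icc_self hc
  have hA : 0 < 1 - P c ^ 2 := by linarith [hlt c hc']
  have hne := hcos c hc'
  have hB : 0 < cos (ω * c) ^ 2 := by positivity
  have hs : 1 - sin (ω * c) ^ 2 = cos (ω * c) ^ 2 := by linarith [sin_sq_add_cos_sq (ω * c)]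
  have heq : (1 / √(1 - P c ^ 2) * P' c) ^ 2
      = (1 / √(1 - sin (ω * c) ^ 2) * (cos (ω * c) * ω)) ^ 2 := by
    rw [sub_eq_zero.1 hc0]
  rw [hs, mul_pow, mul_pow, div_pow, div_pow, Real.sq_sqrt hA.le, Real.sq_sqrt hB.le,
    mul_pow] at heq
  field_simp at heq
  linarith

lemma card_le_of_sin_eq {P P' : ℝ → ℝ} {ω : ℝ} {L : ℕ} (hP : ∀ x, HasDerivAt P (P' x) x)
    (hω : 0 < ω) (hωL : ω ≤ L) {R Z : Finset ℝ}
    (hR : ∀ x ∈ Set.Icc 0 π, P x ^ 2 = 1 → x ∈ R)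
    (hR' : ∀ x ∈ Set.Icc 0 π, P' x ^ 2 = ω ^ 2 * (1 - P x ^ 2) → x ∈ R)
    (hZ : ∀ z ∈ Z, z ∈ Set.Ioc 0 π ∧ sin (ω * z) = P z) :
    Z.card ≤ 3 * R.card +
      2 * ((Finset.Icc 1 L).filter fun i : ℕ => P (i * π / L) ^ 2 ≤ 1).card + 2 := by
  classical
  set B := (Finset.Icc 1 L).filter fun i : ℕ => P (i * π / L) ^ 2 ≤ 1 with hB
  have hL : (0 : ℝ) < L := hω.trans_le hωL
  have hcont : Continuous P := continuous_iff_continuousAt.2 fun x => (hP x).continuousAt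
  have hsq : ∀ z ∈ Z \ R, P z ^ 2 < 1 := by
    intro z hz
    obtain ⟨hz, hzR⟩ := Finset.mem_sdiff.1 hz
    obtain ⟨⟨h0, hπ⟩, hs⟩ := hZ z hz
    refine lt_of_le_of_ne ?_ fun h => hzR (hR z ⟨h0.le, hπ⟩ h)
    rw [← hs]
    exact sin_sq_le_one _
  have hcosne : ∀ z ∈ Z \ R, cos (ω * z) ≠ 0 := by
    intro z hz h
    have h1 := hsq z hz
    have := sin_sq_add_cos_sq (ω * z)
    rw [(hZ z (Finset.mem_sdiff.1 hz).1).2, h] at this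
    linarith
  have key : (Z \ R).card ≤ 2 * (R ∪ B.image fun i : ℕ => (i * π / L : ℝ)).card + 2 := by
    refine Finset.card_le_two_mul_card_add_two fun x hx y hy z hz hxy hyz => ?_
    by_contra! hno
    have hnoR : ∀ w ∈ R, x ≤ w → z ≤ w := fun w hw => hno w (Finset.mem_union_left _ hw)
    obtain ⟨⟨hx0, hxπ⟩, hsx⟩ := hZ x (Finset.mem_sdiff.1 hx).1
    obtain ⟨-, hsy⟩ := hZ y (Finset.mem_sdiff.1 hy).1
    obtain ⟨⟨hz0, hzπ⟩, hsz⟩ := hZ z (Finset.mem_sdiff.1 hz).1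
    have hlt : ∀ c ∈ Set.Icc x z, P c ^ 2 < 1 := by
      intro c hc
      by_contra! hge
      obtain ⟨d, hd, hd1⟩ := intermediate_value_Icc hc.1 (f := fun t => P t ^ 2)
        (by fun_prop) ⟨(hsq x hx).le, hge⟩
      have hdR : d ∈ R := hR d ⟨by linarith [hd.1], by linarith [hd.2, hc.2]⟩ hd1
      have : d = z := le_antisymm (hd.2.trans hc.2) (hnoR d hdR hd.1)
      exact (Finset.mem_sdiff.1 hz).2 (this ▸ hdR)
    have rolle : ∀ u v, x ≤ u → u < v → v ≤ z → sin (ω * u) = P u → sin (ω * v) = P v →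
        ∃ c ∈ Set.Icc u v, cos (ω * c) = 0 := by
      intro u v hxu huv hvz hu hv
      by_contra! hne
      obtain ⟨c, hc, hceq⟩ := exists_deriv_sq_eq_of_sin_eq hP huv
        (fun c hc => hlt c ⟨hxu.trans hc.1, hc.2.trans hvz⟩) hne hu hv
      have := hnoR c (hR' c ⟨by linarith [hc.1], by linarith [hc.2]⟩ hceq) (by linarith [hc.1])
      linarith [hc.2]
    obtain ⟨c, hc, hc0⟩ := rolle x y le_rfl hxy hyz.le hsx hsy
    obtain ⟨d, hd, hd0⟩ := rolle y z hxy.le hyz le_rfl hsy hsz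
    have hcd : c < d := lt_of_le_of_ne (hc.2.trans hd.1) fun h =>
      hcosne y hy (by rwa [← le_antisymm hc.2 (h ▸ hd.1)])
    have hgap : π / L ≤ z - x := by
      by_contra! hlt
      have h1 : ω * (d - c) < π := by
        calc ω * (d - c) ≤ L * (z - x) := by
              apply mul_le_mul hωL <;> linarith [hc.1, hd.2]
          _ < L * (π / L) := by gcongr
          _ = π := by field_simp
      have h2 := sin_pos_of_pos_of_lt_pi (mul_pos hω (sub_pos.2 hcd)) h1
      rw [mul_sub, sin_sub, hc0, hd0] at h2
      simp at h2
    set i := ⌈x * L / π⌉₊ with hi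
    have hpi := pi_pos
    have hi1 : x ≤ i * π / L := by
      rw [le_div_iff₀ hL, ← div_le_iff₀ hpi]
      exact Nat.le_ceil _
    have hi2 : i * π / L < z := by
      have : (i : ℝ) < x * L / π + 1 := Nat.ceil_lt_add_one (by positivity)
      calc i * π / L < (x * L / π + 1) * π / L := by gcongr
        _ = x + π / L := by field_simp
        _ ≤ z := by linarith
    refine (hno (i * π / L) (Finset.mem_union_right _ (Finset.mem_image_of_mem _ ?_)) hi1).not_gt hi2
    refine Finset.mem_filter.2 ⟨Finset.mem_Icc.2 ⟨Nat.ceil_pos.2 (by positivity), ?_⟩,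
      (hlt _ ⟨hi1, hi2.le⟩).le⟩
    have : i * π / L < π := hi2.trans_le hzπ
    rw [div_lt_iff₀ hL, mul_comm, mul_lt_mul_iff_right₀ hpi] at this
    exact_mod_cast this.le
  have h1 : Z.card ≤ (Z \ R).card + R.card := Finset.card_le_card_sdiff_add_card
  have h2 := Finset.card_union_le R (B.image fun i : ℕ => (i * π / L : ℝ))
  have h3 : (B.image fun i : ℕ => (i * π / L : ℝ)).card ≤ B.card := Finset.card_image_le
  omega

lemma Nat.centralBinom_sq_mul_le (p : ℕ) : p.centralBinom ^ 2 * (3 * p + 1) ≤ 16 ^ p := by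
  induction p with
  | zero => simp
  | succ p ih =>
    have h := Nat.succ_mul_centralBinom_succ p
    refine Nat.le_of_mul_le_mul_left ?_ (pow_pos p.succ_pos 2)
    calc (p + 1) ^ 2 * ((p + 1).centralBinom ^ 2 * (3 * (p + 1) + 1))
        = ((p + 1) * (p + 1).centralBinom) ^ 2 * (3 * p + 4) := by ring
      _ = 4 * p.centralBinom ^ 2 * ((2 * p + 1) ^ 2 * (3 * p + 4)) := by rw [h]; ring
      _ ≤ 4 * p.centralBinom ^ 2 * (4 * (p + 1) ^ 2 * (3 * p + 1)) := by
        gcongr 4 * p.centralBinom ^ 2 * ?_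
        nlinarith
      _ = 16 * (p + 1) ^ 2 * (p.centralBinom ^ 2 * (3 * p + 1)) := by ring
      _ ≤ 16 * (p + 1) ^ 2 * 16 ^ p := by gcongr
      _ = (p + 1) ^ 2 * 16 ^ (p + 1) := by ring

open Finset in
/-- The Littlewood–Offord inequality of Erdős. -/
lemma card_sum_mem_Ico_le {α : Type*} [Fintype α] [DecidableEq α] {a : α → ℝ} {δ : ℝ}
    (ha : ∀ i, δ ≤ |a i|) (c : ℝ) :
    #{V : Finset α | ∑ i ∈ V, a i ∈ Set.Ico c (c + δ)} ≤
      (Fintype.card α).choose (Fintype.card α / 2) := by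
  classical
  set 𝒱 : Finset (Finset α) := {V : Finset α | ∑ i ∈ V, a i ∈ Set.Ico c (c + δ)} with h𝒱
  let N : Finset α := {i | a i < 0}
  have hsum : ∀ V : Finset α,
      ∑ i ∈ symmDiff V N, |a i| = ∑ i ∈ V, a i + ∑ i ∈ N, |a i| := by
    intro V
    rw [← sum_filter_add_sum_filter_not V (fun i => i ∈ N), ← sum_filter_add_sum_filter_not N
      (fun i => i ∈ V), symmDiff_def, sup_eq_union, sum_union disjoint_sdiff_sdiff]
    have h1 : V \ N = V.filter fun i => i ∉ N := by ext; simp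
    have h2 : N \ V = N.filter fun i => i ∉ V := by ext; simp
    have h3 : ∑ i ∈ V with i ∉ N, |a i| = ∑ i ∈ V with i ∉ N, a i :=
      sum_congr rfl fun i hi => abs_of_nonneg (by simpa [N] using (mem_filter.1 hi).2)
    have h4 : ∑ i ∈ N with i ∈ V, |a i| = -∑ i ∈ V with i ∈ N, a i := by
      rw [← sum_neg_distrib, filter_mem_eq_inter, filter_mem_eq_inter, inter_comm]
      exact sum_congr rfl fun i hi => abs_of_neg (by simpa [N] using (mem_inter.1 hi).2)
    rw [h1, h2, h3, h4]
    ring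
  rw [← card_image_of_injective 𝒱 (symmDiff_left_injective N)]
  refine IsAntichain.sperner ?_
  intro A hA B hB hAB hsub
  obtain ⟨V, hV, rfl⟩ := mem_image.1 (mem_coe.1 hA)
  obtain ⟨W, hW, rfl⟩ := mem_image.1 (mem_coe.1 hB)
  simp only [h𝒱, mem_filter, mem_univ, true_and, Set.mem_Ico] at hV hW
  obtain ⟨i, hiB, hiA⟩ := exists_of_ssubset (hsub.ssubset_of_ne hAB)
  have h : |a i| + ∑ j ∈ symmDiff V N, |a j| ≤ ∑ j ∈ symmDiff W N, |a j| := by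
    rw [← sum_insert (f := fun j => |a j|) hiA]
    exact sum_le_sum_of_subset_of_nonneg (insert_subset hiB hsub) fun _ _ _ => abs_nonneg _
  rw [hsum, hsum] at h
  linarith [ha i]

open Finset in
lemma card_powerset_abs_sum_sub_le {s U : Finset ℕ} (hU : U ⊆ s) {a : ℕ → ℝ} {δ : ℝ}
    (hδ : 0 < δ) (ha : ∀ k ∈ U, δ ≤ |a k|) (c r : ℝ) :
    (#{T ∈ s.powerset | |∑ k ∈ T, a k - c| ≤ r} : ℝ) ≤
      2 ^ (#s - #U) * (⌊2 * r / δ⌋₊ + 1) * (#U).choose (#U / 2) := by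
  classical
  set 𝒯 := {T ∈ s.powerset | |∑ k ∈ T, a k - c| ≤ r} with h𝒯
  let φ : Finset ℕ → Finset ℕ × ℕ := fun T => (T \ U, ⌊(∑ k ∈ T, a k - (c - r)) / δ⌋₊)
  have hmaps : ∀ T ∈ 𝒯, φ T ∈ (s \ U).powerset ×ˢ range (⌊2 * r / δ⌋₊ + 1) := by
    intro T hT
    obtain ⟨hT, hr⟩ := mem_filter.1 hT
    rw [abs_le] at hr
    simp only [φ, mem_product, mem_powerset, mem_range]
    refine ⟨sdiff_subset_sdiff (mem_powerset.1 hT) le_rfl, Nat.lt_succ_of_le ?_⟩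
    gcongr
    linarith
  have hfib : ∀ b ∈ (s \ U).powerset ×ˢ range (⌊2 * r / δ⌋₊ + 1),
      #{T ∈ 𝒯 | φ T = b} ≤ (#U).choose (#U / 2) := by
    rintro ⟨T₀, j⟩ -
    have hLO := card_sum_mem_Ico_le (α := U) (a := fun i => a i) (fun i => ha i i.2)
      (c - r + j * δ - ∑ k ∈ T₀, a k)
    rw [Fintype.card_coe] at hLO
    refine le_trans (card_le_card_of_injOn (fun T => T.subtype (· ∈ U)) ?_ ?_) hLO
    · intro T hT
      simp only [mem_coe, mem_filter, φ, Prod.mk.injEq, h𝒯] at hT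
      obtain ⟨⟨-, hr⟩, hT₀, hj⟩ := hT
      have hsum : ∑ i ∈ T.subtype (· ∈ U), a i = ∑ k ∈ T, a k - ∑ k ∈ T₀, a k := by
        rw [sum_subtype_eq_sum_filter (f := a), ← hT₀, ← sum_filter_add_sum_filter_not T (· ∈ U)]
        have : T \ U = T.filter fun i => i ∉ U := by ext; simp
        rw [this]
        ring
      have hnn : 0 ≤ (∑ k ∈ T, a k - (c - r)) / δ :=
        div_nonneg (by linarith [(abs_le.1 hr).1]) hδ.le
      obtain ⟨h1, h2⟩ := (Nat.floor_eq_iff hnn).1 hj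
      rw [le_div_iff₀ hδ] at h1
      rw [div_lt_iff₀ hδ] at h2
      simp only [coe_filter, mem_univ, true_and, Set.mem_ofPred_eq, Set.mem_Ico]
      rw [hsum]
      constructor <;> linarith
    · intro T hT T' hT' heq
      simp only [mem_coe, mem_filter, φ, Prod.mk.injEq] at hT hT'
      ext k
      by_cases hk : k ∈ U
      · have := congrArg (fun V => (⟨k, hk⟩ : U) ∈ V) heq
        simpa using this
      · have h1 : k ∈ T \ U ↔ k ∈ T' \ U := by rw [hT.2.1, hT'.2.1]
        simpa [hk] using h1
  have h := card_le_mul_card_image_of_maps_to hmaps _ hfib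
  rw [card_product, card_powerset, card_range, card_sdiff_of_subset hU] at h
  calc (#𝒯 : ℝ) ≤ ((#U).choose (#U / 2) * (2 ^ (#s - #U) * (⌊2 * r / δ⌋₊ + 1)) : ℕ) := by
        exact_mod_cast h
    _ = _ := by push_cast; ring

lemma one_half_le_abs_cos_two_mul {y : ℝ} (h : |cos y| < 1 / 2) : 1 / 2 ≤ |cos (2 * y)| := by
  have h2 : cos y ^ 2 < (1 / 2) ^ 2 := by rw [← sq_abs]; gcongr
  rw [cos_two_mul, abs_sub_comm]
  exact le_trans (by linarith) (le_abs_self _)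

open Finset in
lemma exists_subset_one_half_le_abs_cos (x : ℝ) {q M : ℕ} (hq : 4 * q ≤ M) :
    ∃ U ⊆ range M, #U = q ∧ ∀ k ∈ U, 1 / 2 ≤ |cos ((k : ℕ) * x)| := by
  classical
  let u : ℕ → ℕ := fun j =>
    if |cos ((2 * j + 1 : ℕ) * x)| < 1 / 2 then 2 * (2 * j + 1) else 2 * j + 1
  refine ⟨(range q).image u, ?_, ?_, ?_⟩
  · intro k hk
    obtain ⟨j, hj, rfl⟩ := mem_image.1 hk
    rw [mem_range] at hj ⊢
    simp only [u]
    split_ifs <;> omega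
  · rw [card_image_of_injective, card_range]
    intro i j hij
    simp only [u] at hij
    split_ifs at hij <;> omega
  · intro k hk
    obtain ⟨j, -, rfl⟩ := mem_image.1 hk
    simp only [u]
    split_ifs with h
    · have := one_half_le_abs_cos_two_mul h
      rwa [← mul_assoc, ← Nat.cast_ofNat, ← Nat.cast_mul] at this
    · exact not_lt.1 h

open Finset in
lemma card_powerset_abs_sum_cos_sub_le {M : ℕ} (hM : 0 < M) (x c : ℝ) {r : ℝ} (hr : 1 / 2 ≤ r) :
    (#{T ∈ (range M).powerset | |∑ k ∈ T, cos ((k : ℕ) * x) - c| ≤ r} : ℝ) ≤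
      2 ^ M * (18 * r / √M) := by
  set p := M / 8 with hp
  obtain ⟨U, hU, hcard, hcos⟩ := exists_subset_one_half_le_abs_cos x (q := 2 * p) (M := M) (by omega)
  refine (card_powerset_abs_sum_sub_le hU one_half_pos hcos c r).trans ?_
  have hfloor : (⌊2 * r / (1 / 2)⌋₊ : ℝ) ≤ 4 * r := by
    refine (Nat.floor_le (by positivity)).trans (by linarith)
  have hMpos : (0 : ℝ) < M := by exact_mod_cast hM
  have hchoose : ((2 * p).choose (2 * p / 2) : ℝ) ≤ 2 ^ (2 * p) * (3 / √M) := by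
    have h1 := Nat.centralBinom_sq_mul_le p
    rw [Nat.mul_div_cancel_left p two_pos, ← Nat.centralBinom_eq_two_mul_choose]
    refine (pow_le_pow_iff_left₀ (by positivity) (by positivity) two_ne_zero).1 ?_
    rw [mul_pow, div_pow, Real.sq_sqrt hMpos.le, ← pow_mul, mul_comm _ 2, ← mul_assoc, pow_mul,
      ← mul_div_assoc, le_div_iff₀ hMpos]
    have h2 : (M : ℝ) ≤ 9 * (3 * p + 1) := by
      have : M ≤ 9 * (3 * p + 1) := by omega
      exact_mod_cast this
    calc (p.centralBinom : ℝ) ^ 2 * M ≤ p.centralBinom ^ 2 * (9 * (3 * p + 1)) := by gcongr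
      _ = 9 * ((p.centralBinom ^ 2 * (3 * p + 1) : ℕ) : ℝ) := by push_cast; ring
      _ ≤ 9 * ((16 ^ p : ℕ) : ℝ) := by gcongr
      _ = _ := by push_cast; norm_num; ring
  rw [hcard, card_range]
  calc (2 : ℝ) ^ (M - 2 * p) * (⌊2 * r / (1 / 2)⌋₊ + 1) * (2 * p).choose (2 * p / 2)
      ≤ 2 ^ (M - 2 * p) * (4 * r + 2 * r) * (2 ^ (2 * p) * (3 / √M)) := by
        gcongr
        linarith
    _ = 2 ^ (M - 2 * p) * 2 ^ (2 * p) * (18 * r / √M) := by ring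
    _ = _ := by rw [← pow_add, Nat.sub_add_cancel (by omega)]

open Finset in
lemma exists_subset_card_abs_sum_cos_sub_le {n M : ℕ} (hn : 2 ≤ n) (hM : 0 < M) (x : ℕ → ℝ)
    (c : ℝ) :
    ∃ T ⊆ range M,
      (#{i ∈ Icc 1 (2 * n) | |∑ k ∈ T, cos ((k : ℕ) * x i) - c| ≤ n / (i : ℕ)} : ℝ) ≤
        72 * (n * log n / √M) := by
  set B : Finset ℕ → ℝ := fun T =>
    (#{i ∈ Icc 1 (2 * n) | |∑ k ∈ T, cos ((k : ℕ) * x i) - c| ≤ n / (i : ℕ)} : ℝ) with hB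
  have hn0 : (0 : ℝ) < n := by positivity
  have hharm : ∑ i ∈ Icc 1 (2 * n), (i : ℝ)⁻¹ ≤ 4 * log n := by
    have h := harmonic_le_one_add_log (2 * n)
    rw [harmonic_eq_sum_Icc] at h
    push_cast at h
    rw [log_mul two_ne_zero hn0.ne'] at h
    have h2 : log 2 ≤ log n := log_le_log two_pos (by exact_mod_cast hn)
    linarith [log_two_gt_d9]
  have hsum : ∑ T ∈ (range M).powerset, B T ≤
      ∑ _T ∈ (range M).powerset, 72 * (n * log n / √M) := by
    calc ∑ T ∈ (range M).powerset, B T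
        = ∑ i ∈ Icc 1 (2 * n),
          (#{T ∈ (range M).powerset | |∑ k ∈ T, cos ((k : ℕ) * x i) - c| ≤ n / (i : ℕ)} : ℝ) := by
          simp only [hB, card_filter, Nat.cast_sum]
          exact sum_comm
      _ ≤ ∑ i ∈ Icc 1 (2 * n), 2 ^ M * (18 * (n / (i : ℕ)) / √M) := by
          refine sum_le_sum fun i hi => card_powerset_abs_sum_cos_sub_le hM _ _ ?_
          obtain ⟨h1, h2⟩ := mem_Icc.1 hi
          have h1' : (0 : ℝ) < i := by exact_mod_cast h1
          have h2' : (i : ℝ) ≤ 2 * n := by exact_mod_cast h2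
          rw [le_div_iff₀ h1']
          linarith
      _ = 2 ^ M * (18 * n / √M) * ∑ i ∈ Icc 1 (2 * n), (i : ℝ)⁻¹ := by
          rw [mul_sum]
          exact sum_congr rfl fun i _ => by ring
      _ ≤ 2 ^ M * (18 * n / √M) * (4 * log n) := by gcongr
      _ = _ := by
          rw [sum_const, card_powerset, card_range, nsmul_eq_mul]
          push_cast
          ring
  obtain ⟨T, hT, hTB⟩ := exists_le_of_sum_le (powerset_nonempty _) hsum
  exact ⟨T, mem_powerset.1 hT, hTB⟩

open Polynomial in
lemma exists_finset_of_eval_cos {q : ℝ[X]} (hq : q ≠ 0) :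
    ∃ R : Finset ℝ, R.card ≤ q.natDegree ∧
      ∀ x ∈ Set.Icc 0 π, q.eval (cos x) = 0 → x ∈ R := by
  classical
  refine ⟨q.roots.toFinset.image arccos, ?_, fun x hx h => ?_⟩
  · exact Finset.card_image_le.trans ((Multiset.toFinset_card_le _).trans (card_roots' q))
  · exact Finset.mem_image.2 ⟨cos x, by simp [hq, h], arccos_cos hx.1 hx.2⟩

lemma four_mul_sin_half_sq (x : ℝ) : 4 * sin (x / 2) ^ 2 = 2 * (1 - cos x) := by
  have h := cos_sq (x / 2)
  rw [mul_div_cancel₀ x two_ne_zero] at h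
  rw [sin_sq, h]
  ring

lemma two_mul_sin_half_mul_cos_half (x : ℝ) : 2 * sin (x / 2) * cos (x / 2) = sin x := by
  rw [← sin_two_mul, mul_div_cancel₀ x two_ne_zero]

open Polynomial in
lemma hasDerivAt_two_mul_sin_half_mul_eval_cos (G : ℝ[X]) (x : ℝ) :
    HasDerivAt (fun t => 2 * sin (t / 2) * G.eval (cos t))
      (cos (x / 2) * G.eval (cos x) - 2 * sin (x / 2) * sin x * (derivative G).eval (cos x)) x := by
  have h1 := ((hasDerivAt_id x).div_const 2).sin.const_mul 2
  have h2 := (G.hasDerivAt (cos x)).comp x (hasDerivAt_cos x)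
  exact (h1.mul h2).congr_deriv (by simp; ring)

open Polynomial in
lemma exists_finset_of_sin_half_mul_eval_cos {G : ℝ[X]} {M : ℕ} (hG : G.natDegree ≤ M) {ω : ℝ}
    (hω : G.eval 1 ^ 2 ≠ ω ^ 2) :
    ∃ R : Finset ℝ, R.card ≤ 4 * M + 4 ∧
      (∀ x ∈ Set.Icc 0 π, (2 * sin (x / 2) * G.eval (cos x)) ^ 2 = 1 → x ∈ R) ∧
      ∀ x ∈ Set.Icc 0 π,
        (cos (x / 2) * G.eval (cos x) - 2 * sin (x / 2) * sin x * (derivative G).eval (cos x)) ^ 2 =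
          ω ^ 2 * (1 - (2 * sin (x / 2) * G.eval (cos x)) ^ 2) → x ∈ R := by
  let q₁ : ℝ[X] := C 2 * (1 - X) * G ^ 2 - 1
  let q₂ : ℝ[X] := C (1 / 2) * (1 + X) * G ^ 2 - C 2 * (1 - X ^ 2) * (G * derivative G)
    + C 2 * (1 - X) * (1 - X ^ 2) * derivative G ^ 2 - C (ω ^ 2) * (1 - C 2 * (1 - X) * G ^ 2)
  have hG' : (derivative G).natDegree ≤ M := G.natDegree_derivative_le.trans (by omega)
  have hX : (1 - X : ℝ[X]).natDegree ≤ 1 := by compute_degree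
  have hX' : (1 + X : ℝ[X]).natDegree ≤ 1 := by compute_degree
  have hX2 : (1 - X ^ 2 : ℝ[X]).natDegree ≤ 2 := by compute_degree
  have hGG : (G ^ 2).natDegree ≤ 2 * M := natDegree_pow_le_of_le 2 hG
  have hGG' : (derivative G ^ 2).natDegree ≤ 2 * M := natDegree_pow_le_of_le 2 hG'
  have hq₁ : q₁.natDegree ≤ 2 * M + 1 := by
    have h₁ := natDegree_mul_le_of_le (natDegree_mul_le_of_le (natDegree_C (2 : ℝ)).le hX) hGG
    exact (natDegree_sub_le_of_le h₁ natDegree_one.le).trans (by omega)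
  have hq₂ : q₂.natDegree ≤ 2 * M + 3 := by
    have h₁ := natDegree_mul_le_of_le
      (natDegree_mul_le_of_le (natDegree_C (1 / 2 : ℝ)).le hX') hGG
    have h₂ := natDegree_mul_le_of_le
      (natDegree_mul_le_of_le (natDegree_C (2 : ℝ)).le hX2) (natDegree_mul_le_of_le hG hG')
    have h₃ := natDegree_mul_le_of_le (natDegree_mul_le_of_le
      (natDegree_mul_le_of_le (natDegree_C (2 : ℝ)).le hX) hX2) hGG'
    have h₄ := natDegree_mul_le_of_le (natDegree_C (ω ^ 2)).le
      (natDegree_sub_le_of_le natDegree_one.le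
        (natDegree_mul_le_of_le (natDegree_mul_le_of_le (natDegree_C (2 : ℝ)).le hX) hGG))
    exact (natDegree_sub_le_of_le
      (natDegree_add_le_of_le (natDegree_sub_le_of_le h₁ h₂) h₃) h₄).trans (by omega)
  have hne₁ : q₁ ≠ 0 := fun h => by simpa [q₁] using congrArg (eval 1) h
  have hne₂ : q₂ ≠ 0 := fun h => hω <| by
    have := congrArg (eval 1) h
    simp [q₂] at this
    linarith
  obtain ⟨R, hcard, hR⟩ := exists_finset_of_eval_cos (mul_ne_zero hne₁ hne₂)
  have hsq : ∀ x, (2 * sin (x / 2) * G.eval (cos x)) ^ 2 =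
      2 * (1 - cos x) * G.eval (cos x) ^ 2 := fun x => by
    rw [← four_mul_sin_half_sq]
    ring
  refine ⟨R, hcard.trans (natDegree_mul_le.trans (by omega)), fun x hx h => hR x hx ?_,
    fun x hx h => hR x hx ?_⟩
  · rw [hsq] at h
    simp [q₁, h]
  · have hc : 2 * cos (x / 2) ^ 2 = 1 + cos x := by
      linarith [four_mul_sin_half_sq x, sin_sq_add_cos_sq (x / 2)]
    have hs := sin_sq x
    have hsq' : (cos (x / 2) * G.eval (cos x)
        - 2 * sin (x / 2) * sin x * (derivative G).eval (cos x)) ^ 2 =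
        1 / 2 * (1 + cos x) * G.eval (cos x) ^ 2
        - 2 * (1 - cos x ^ 2) * (G.eval (cos x) * (derivative G).eval (cos x))
        + 2 * (1 - cos x) * (1 - cos x ^ 2) * (derivative G).eval (cos x) ^ 2 := by
      rw [← hc, ← four_mul_sin_half_sq, ← hs]
      linear_combination (-2 * sin x * (G.eval (cos x) * (derivative G).eval (cos x))) *
        two_mul_sin_half_mul_cos_half x
    rw [hsq', hsq] at h
    simp only [q₁, q₂, eval_mul, eval_sub, eval_add, eval_pow, eval_C, eval_X, eval_one, h]
    ring

lemma two_mul_sin_half_mul_sum_range_cos (K : ℕ) (x : ℝ) :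
    2 * sin (x / 2) * ∑ k ∈ Finset.range K, cos (k * x) =
      sin ((K - 1 / 2) * x) + sin (x / 2) := by
  induction K with
  | zero =>
    rw [show ((0 : ℕ) - 1 / 2 : ℝ) * x = -(x / 2) by push_cast; ring]
    simp
  | succ K ih =>
    rw [Finset.sum_range_succ, mul_add, ih,
      show ((K - 1 / 2 : ℝ) * x) = K * x - x / 2 by ring,
      show (((K + 1 : ℕ) - 1 / 2 : ℝ) * x) = K * x + x / 2 by push_cast; ring, sin_add, sin_sub]
    ring

open Polynomial in
lemma exists_polynomial_eval_cos_eq_sum {T : Finset ℕ} {M : ℕ} (hT : T ⊆ Finset.range M) (c : ℝ) :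
    ∃ G : ℝ[X], G.natDegree ≤ M ∧ G.eval 1 = T.card - c ∧
      ∀ x, G.eval (cos x) = ∑ k ∈ T, cos (k * x) - c := by
  refine ⟨∑ k ∈ T, Chebyshev.T ℝ k - C c, ?_, ?_, fun x => ?_⟩
  · refine (natDegree_sub_le_of_le (natDegree_sum_le_of_forall_le T _ fun k hk => ?_)
      (natDegree_C c).le).trans (max_eq_left M.zero_le).le
    have := Finset.mem_range.1 (hT hk)
    rw [Chebyshev.natDegree_T]
    simpa using this.le
  · simp [eval_finsetSum]
  · simp [eval_finsetSum]

lemma one_le_mul_log {n : ℕ} (hn : 2 ≤ n) : 1 ≤ n * log n := by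
  have hn' : (2 : ℝ) ≤ n := by exact_mod_cast hn
  have h := log_le_log two_pos hn'
  nlinarith [log_two_gt_d9]

lemma mul_log_rpow_le (n : ℕ) : ((n : ℝ) * log n) ^ ((2 : ℝ) / 3) ≤ n := by
  rcases Nat.eq_zero_or_pos n with rfl | hn
  · simp
  have hn' : (1 : ℝ) ≤ n := by exact_mod_cast hn
  have hlog : log n ≤ √n := by
    have h := log_le_sub_one_of_pos (x := √n / 2) (by positivity)
    rw [log_div (by positivity) two_ne_zero, log_sqrt (by positivity)] at h
    linarith [log_two_lt_d9]
  calc ((n : ℝ) * log n) ^ ((2 : ℝ) / 3) ≤ ((n : ℝ) * √n) ^ ((2 : ℝ) / 3) := by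
        gcongr
    _ = ((n : ℝ) ^ ((3 : ℝ) / 2)) ^ ((2 : ℝ) / 3) := by
        rw [sqrt_eq_rpow]
        nth_rewrite 1 [← rpow_one (n : ℝ)]
        rw [← rpow_add (by positivity)]
        norm_num
    _ = n := by
        rw [← rpow_mul (by positivity)]
        norm_num

lemma zeros_Icc_two_pi_le {f : ℝ → ℝ} (hf : ∀ x, f (2 * π - x) = f x) {b : ℕ}
    (hb : ∀ Z : Finset ℝ, (∀ z ∈ Z, z ∈ Set.Icc 0 π ∧ f z = 0) → Z.card ≤ b) :
    zeros f (Set.Icc 0 (2 * π)) ≤ 2 * b := by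
  classical
  unfold zeros
  rcases Set.finite_or_infinite {x ∈ Set.Icc 0 (2 * π) | f x = 0} with hfin | hinf
  · rw [Set.ncard_eq_toFinset_card _ hfin]
    set S := hfin.toFinset
    have hS : S ⊆ S.filter (· ≤ π) ∪ (S.filter (· ≤ π)).image fun x => 2 * π - x := by
      intro x hx
      have hx' := hfin.mem_toFinset.1 hx
      rcases le_total x π with h | h
      · exact Finset.mem_union_left _ (Finset.mem_filter.2 ⟨hx, h⟩)
      · refine Finset.mem_union_right _ (Finset.mem_image.2 ⟨2 * π - x,
          Finset.mem_filter.2 ⟨hfin.mem_toFinset.2 ⟨⟨?_, ?_⟩, ?_⟩, ?_⟩, ?_⟩)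
        · linarith [hx'.1.2]
        · linarith [hx'.1.1]
        · rw [hf, hx'.2]
        · linarith
        · ring
    have hhalf : (S.filter (· ≤ π)).card ≤ b := by
      refine hb _ fun z hz => ?_
      obtain ⟨hz, hzπ⟩ := Finset.mem_filter.1 hz
      have hz' := hfin.mem_toFinset.1 hz
      exact ⟨⟨hz'.1.1, hzπ⟩, hz'.2⟩
    have h1 := (Finset.card_le_card hS).trans (Finset.card_union_le _ _)
    have h2 := (S.filter (· ≤ π)).card_image_le (f := fun x => 2 * π - x)
    omega
  · rw [hinf.ncard]
    exact Nat.zero_le _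

lemma exists_card_eq_zeros_le {n M : ℕ} (hn : 2 ≤ n) (hM : 0 < M) (hMn : M ≤ n) :
    ∃ A : Finset ℕ, A.card = n ∧
      (zeros (fun x => ∑ a ∈ A, cos (a * x)) (Set.Icc 0 (2 * π)) : ℝ) ≤
        24 * M + 28 + 288 * (n * log n / √M) := by
  classical
  have hn' : (2 : ℝ) ≤ n := by exact_mod_cast hn
  obtain ⟨T, hT, hB⟩ := exists_subset_card_abs_sum_cos_sub_le hn hM
    (fun i => i * π / (2 * n : ℕ)) (1 / 2)
  obtain ⟨G, hGdeg, hG1, hG⟩ := exists_polynomial_eval_cos_eq_sum hT (1 / 2)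
  set t := T.card with ht
  have htM : t ≤ M := by simpa using Finset.card_le_card hT
  have hTsub : T ⊆ Finset.range (n + t) :=
    hT.trans (Finset.range_subset_range.2 (by omega))
  set ω : ℝ := (n + t : ℕ) - 1 / 2 with hωdef
  have hωeq : ω = n + (t - 1 / 2) := by rw [hωdef]; push_cast; ring
  have htn : (t : ℝ) ≤ n := by exact_mod_cast htM.trans hMn
  have ht0 : (0 : ℝ) ≤ t := t.cast_nonneg
  have hω0 : 0 < ω := by linarith
  have hωL : ω ≤ (2 * n : ℕ) := by push_cast; linarith
  obtain ⟨R, hRcard, hR, hR'⟩ := exists_finset_of_sin_half_mul_eval_cos hGdeg (ω := ω) (by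
    rw [hG1, hωeq]
    nlinarith)
  set B := {i ∈ Finset.Icc 1 (2 * n) |
    |∑ k ∈ T, cos ((k : ℕ) * ((i : ℕ) * π / (2 * n : ℕ))) - 1 / 2| ≤ n / (i : ℕ)} with hBdef
  have hA : (Finset.range (n + t) \ T).card = n := by
    rw [Finset.card_sdiff_of_subset hTsub, Finset.card_range, ← ht, Nat.add_sub_cancel]
  refine ⟨Finset.range (n + t) \ T, hA, ?_⟩
  have hsin : ∀ z, ∑ a ∈ Finset.range (n + t) \ T, cos (a * z) = 0 →
      sin (ω * z) = 2 * sin (z / 2) * G.eval (cos z) := by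
    intro z hz
    have h1 := two_mul_sin_half_mul_sum_range_cos (n + t) z
    rw [← Finset.sum_sdiff hTsub, hz] at h1
    rw [hG]
    linear_combination -h1
  have hfilter : (Finset.Icc 1 (2 * n)).filter (fun i : ℕ =>
      (2 * sin (i * π / (2 * n : ℕ) / 2) * G.eval (cos (i * π / (2 * n : ℕ)))) ^ 2 ≤ 1) ⊆ B := by
    refine Finset.monotone_filter_right _ fun i hi h => ?_
    obtain ⟨hi1, hi2⟩ := Finset.mem_Icc.1 hi
    have hi1' : (0 : ℝ) < i := by exact_mod_cast hi1
    have hi2' : (i : ℝ) ≤ 2 * n := by exact_mod_cast hi2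
    have hpi := pi_pos
    have hle : i * π / (2 * n : ℕ) / 2 ≤ π / 2 := by
      gcongr
      rw [div_le_iff₀ (by positivity)]
      push_cast
      nlinarith
    have hs : (i : ℝ) / n ≤ 2 * sin (i * π / (2 * n : ℕ) / 2) := by
      refine le_trans (le_of_eq ?_)
        (mul_le_mul_of_nonneg_left (mul_le_sin (by positivity) hle) zero_le_two)
      push_cast
      field_simp
    rw [sq_le_one_iff_abs_le_one, abs_mul, hG] at h
    have h2 := (mul_le_mul_of_nonneg_right (hs.trans (le_abs_self _)) (abs_nonneg _)).trans h
    rw [le_div_iff₀ hi1']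
    rw [div_mul_eq_mul_div, div_le_one (by positivity)] at h2
    linarith
  have hzeros := zeros_Icc_two_pi_le
    (f := fun x => ∑ a ∈ Finset.range (n + t) \ T, cos (a * x))
    (b := 3 * (4 * M + 4) + 2 * B.card + 2)
    (fun x => Finset.sum_congr rfl fun a _ => by
      rw [mul_sub, cos_nat_mul_two_pi_sub]) fun Z hZ => by
    have h := card_le_of_sin_eq (hasDerivAt_two_mul_sin_half_mul_eval_cos G) hω0 hωL hR hR'
      (Z := Z) fun z hz => by
        obtain ⟨⟨hz0, hzπ⟩, hfz⟩ := hZ z hz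
        refine ⟨⟨lt_of_le_of_ne hz0 ?_, hzπ⟩, hsin z hfz⟩
        rintro rfl
        simp only [mul_zero, cos_zero, Finset.sum_const, hA, nsmul_eq_mul, mul_one] at hfz
        linarith
    have h' := Finset.card_le_card hfilter
    omega
  calc (zeros (fun x => ∑ a ∈ Finset.range (n + t) \ T, cos (a * x)) (Set.Icc 0 (2 * π)) : ℝ)
      ≤ (2 * (3 * (4 * M + 4) + 2 * B.card + 2) : ℕ) := by exact_mod_cast hzeros
    _ = 24 * M + 28 + 4 * (B.card : ℝ) := by push_cast; ring
    _ ≤ 24 * M + 28 + 4 * (72 * (n * log n / √M)) := by gcongr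
    _ = _ := by ring

/-- There exists an absolute constant `C > 0` such that for every `n` there is a set
`A ⊆ ℕ` with `|A| = n` such that `f_A(x) = ∑_{a ∈ A} cos (a x)` has at most
`C (n log n)^{2/3}` zeros in `[0, 2π]`. -/
theorem stmt0 :
    ∃ C : ℝ, 0 < C ∧ ∀ n : ℕ, ∃ A : Finset ℕ, A.card = n ∧
      (zeros (fun x => ∑ a ∈ A, Real.cos (a * x)) (Set.Icc 0 (2 * π)) : ℝ) ≤
        C * ((n : ℝ) * Real.log n) ^ ((2 : ℝ) / 3) := by
  refine ⟨364, by norm_num, fun n => ?_⟩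
  rcases lt_or_ge n 2 with hn | hn
  · interval_cases n
    · refine ⟨∅, rfl, ?_⟩
      have hinf : (Set.Icc 0 (2 * π)).Infinite := Set.Icc_infinite two_pi_pos
      have hset : {x ∈ Set.Icc 0 (2 * π) | ∑ a ∈ (∅ : Finset ℕ), cos (a * x) = 0} =
          Set.Icc 0 (2 * π) := by
        ext x
        simp
      rw [zeros, hset, hinf.ncard]
      simp
    · exact ⟨{0}, rfl, by simp [zeros]⟩
  have hy := one_le_mul_log hn
  set y : ℝ := n * log n with hydef
  set w : ℝ := y ^ ((2 : ℝ) / 3) with hw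
  have hw1 : 1 ≤ w := one_le_rpow hy (by norm_num)
  have hM0 : 0 < ⌈w⌉₊ := Nat.ceil_pos.2 (by linarith)
  obtain ⟨A, hA, hzeros⟩ := exists_card_eq_zeros_le hn hM0 (Nat.ceil_le.2 (mul_log_rpow_le n))
  refine ⟨A, hA, hzeros.trans ?_⟩
  have hceil : (⌈w⌉₊ : ℝ) ≤ w + 1 := (Nat.ceil_lt_add_one (by linarith)).le
  have hdiv : y / √(⌈w⌉₊ : ℝ) ≤ w := by
    rw [div_le_iff₀ (by positivity)]
    calc y = w * √w := by
          rw [hw, sqrt_eq_rpow, ← rpow_mul (by linarith), ← rpow_add (by linarith)]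
          norm_num
      _ ≤ w * √(⌈w⌉₊ : ℝ) := by
          gcongr
          exact Nat.le_ceil w
  linarith
end

section
/- There exists an absolute constant C > 0 such that for all integers n ≥ m ≥ 2 the following holds: if f(x) = ∑_{k=0}^{n} cos(kx) − ∑_{k=0}^{m} ε_k cos(kx), where ε_0, …, ε_m are independent random variables taking values 0 and 1 each with probability 1/2, then the expected number of zeros of f in [0, 2π] satisfies E Z(f) ≤ C·(n·(log m)/√m + m). -/
open Real MeasureTheory

/-- The Dirichlet-type kernel `D_n(x) = ∑_{k=0}^n cos (k x)`. -/
noncomputable def Dker (n : ℕ) : ℝ → ℝ := fun x => ∑ k ∈ Finset.range (n + 1), Real.cos (k * x)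

/-- The random polynomial `f ~ F_{n,m}` determined by the Bernoulli outcomes
`e : Fin (m+1) → Bool`:  `f(x) = ∑_{k=0}^n cos(kx) - ∑_{k=0}^m ε_k cos(kx)`. -/
noncomputable def F (n m : ℕ) (e : Fin (m + 1) → Bool) : ℝ → ℝ :=
  fun x => Dker n x - ∑ k : Fin (m + 1), (if e k then (1 : ℝ) else 0) * Real.cos ((k : ℕ) * x)

open scoped Polynomial

/-- With `H y = sin y * P (cos y)`, the polynomial in `cos y` that equals `1 - H y ^ 2`. -/
noncomputable def oneSubSqPoly (P : ℝ[X]) : ℝ[X] := 1 - (1 - .X ^ 2) * P ^ 2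

/-- With `H y = sin y * P (cos y)`, the polynomial in `cos y` that equals `H' y`. -/
noncomputable def derivPoly (P : ℝ[X]) : ℝ[X] :=
  .X * P - (1 - .X ^ 2) * Polynomial.derivative P

/-- With `H y = sin y * P (cos y)`, the polynomial in `cos y` that equals
`(1 - H ^ 2) * (H' ^ 2 - N ^ 2 * (1 - H ^ 2))`. -/
noncomputable def critPoly (P : ℝ[X]) (N : ℕ) : ℝ[X] :=
  oneSubSqPoly P * (derivPoly P ^ 2 - .C ((N : ℝ) ^ 2) * oneSubSqPoly P)

lemma eval_oneSubSqPoly_cos (P : ℝ[X]) (x : ℝ) :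
    (oneSubSqPoly P).eval (cos x) = 1 - (sin x * P.eval (cos x)) ^ 2 := by
  simp only [oneSubSqPoly, Polynomial.eval_sub, Polynomial.eval_one, Polynomial.eval_mul,
    Polynomial.eval_pow, Polynomial.eval_X]
  rw [mul_pow, sin_sq]

lemma hasDerivAt_sin_mul_eval_cos (P : ℝ[X]) (x : ℝ) :
    HasDerivAt (fun x => sin x * P.eval (cos x)) ((derivPoly P).eval (cos x)) x := by
  have h := (hasDerivAt_sin x).mul ((P.hasDerivAt (cos x)).comp x (hasDerivAt_cos x))
  refine h.congr_deriv ?_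
  simp only [derivPoly, Polynomial.eval_sub, Polynomial.eval_one, Polynomial.eval_mul,
    Polynomial.eval_pow, Polynomial.eval_X, Function.comp]
  rw [← sin_sq]; ring

lemma oneSubSqPoly_pos_of_cell {P : ℝ[X]} {N j : ℕ} {y : ℝ} (hy : |N * y - j * π| < π / 2)
    (fy : sin (N * y) = sin y * P.eval (cos y)) : 0 < (oneSubSqPoly P).eval (cos y) := by
  rw [eval_oneSubSqPoly_cos, ← fy]
  have h1 := cos_pos_of_mem_Ioo (abs_lt.1 hy)
  rw [cos_sub_nat_mul_pi] at h1
  have h2 : cos (N * y) ≠ 0 := by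
    rintro h; simp [h] at h1
  have := sin_sq_add_cos_sq (N * y)
  have := sq_pos_of_ne_zero h2
  linarith

lemma exists_critPoly_eq_zero_of_not_pos {P : ℝ[X]} (N : ℕ) {y z : ℝ} (hyz : y ≤ z)
    (hy : 0 < (oneSubSqPoly P).eval (cos y) ∨ 0 < (oneSubSqPoly P).eval (cos z))
    (h : ∃ x ∈ Set.Icc y z, (oneSubSqPoly P).eval (cos x) ≤ 0) :
    ∃ x ∈ Set.Icc y z, (oneSubSqPoly P).eval (cos x) = 0 ∧ (critPoly P N).eval (cos x) = 0 := by
  obtain ⟨x, hx, hx0⟩ := h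
  have hc : ContinuousOn (fun x => (oneSubSqPoly P).eval (cos x)) (Set.Icc y z) := by fun_prop
  have hz : (0 : ℝ) ∈ (fun x => (oneSubSqPoly P).eval (cos x)) '' Set.Icc y z := by
    have hpre := isPreconnected_Icc.image _ hc
    rcases hy with hy | hy
    · exact hpre.ordConnected.out ⟨x, hx, rfl⟩ ⟨y, ⟨le_rfl, hyz⟩, rfl⟩ ⟨hx0, hy.le⟩
    · exact hpre.ordConnected.out ⟨x, hx, rfl⟩ ⟨z, ⟨hyz, le_rfl⟩, rfl⟩ ⟨hx0, hy.le⟩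
  obtain ⟨w, hw, hw0⟩ := hz
  refine ⟨w, hw, hw0, ?_⟩
  simp only at hw0
  simp [critPoly, hw0]

/-- Two solutions of `sin (N y) = H y` in the same monotonicity interval of `sin (N y)` are
separated by a root of `critPoly`. -/
lemma exists_critPoly_root_between {P : ℝ[X]} {N j : ℕ} {y z : ℝ} (hyz : y < z)
    (hy : |N * y - j * π| < π / 2) (hz : |N * z - j * π| < π / 2)
    (fy : sin (N * y) = sin y * P.eval (cos y)) (fz : sin (N * z) = sin z * P.eval (cos z)) :
    ∃ x ∈ Set.Ioo y z, (critPoly P N).eval (cos x) = 0 := by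
  have py := oneSubSqPoly_pos_of_cell hy fy
  have pz := oneSubSqPoly_pos_of_cell hz fz
  by_cases hneg : ∃ x ∈ Set.Icc y z, (oneSubSqPoly P).eval (cos x) ≤ 0
  · obtain ⟨x, hx, h0, h1⟩ := exists_critPoly_eq_zero_of_not_pos N hyz.le (.inl py) hneg
    refine ⟨x, ⟨lt_of_le_of_ne hx.1 ?_, lt_of_le_of_ne hx.2 ?_⟩, h1⟩
    · rintro rfl; exact py.ne' h0
    · rintro rfl; exact pz.ne' h0
  push Not at hneg
  set s : ℝ := (-1) ^ j with hs
  have hs2 : s ^ 2 = 1 := by rw [hs, ← pow_mul, mul_comm, pow_mul]; simp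
  have harc : ∀ w, |N * w - j * π| < π / 2 → sin (N * w) = sin w * P.eval (cos w) →
      arcsin (s * (sin w * P.eval (cos w))) = N * w - j * π := by
    intro w hw fw
    rw [← fw, hs, ← sin_sub_nat_mul_pi, arcsin_sin] <;> linarith [abs_lt.1 hw]
  have hder : ∀ x ∈ Set.Icc y z,
      HasDerivAt (fun x => arcsin (s * (sin x * P.eval (cos x))) - (N * x - j * π))
        (1 / √(1 - (s * (sin x * P.eval (cos x))) ^ 2) * (s * (derivPoly P).eval (cos x)) - N)
        x := by
    intro x hx
    have hp := hneg x hx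
    rw [eval_oneSubSqPoly_cos] at hp
    have hsq : (s * (sin x * P.eval (cos x))) ^ 2 < 1 := by
      rw [mul_pow, hs2]; linarith
    have h1 := (hasDerivAt_sin_mul_eval_cos P x).const_mul s
    have h2 := (hasDerivAt_arcsin (x := s * (sin x * P.eval (cos x)))
      (by rintro h; rw [h] at hsq; norm_num at hsq)
      (by rintro h; rw [h] at hsq; norm_num at hsq)).comp x h1
    have h3 : HasDerivAt (fun x : ℝ => (N : ℝ) * x - j * π) N x := by
      simpa using ((hasDerivAt_id x).const_mul (N : ℝ)).sub_const (j * π)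
    exact h2.sub h3
  obtain ⟨c, hc, hc0⟩ := exists_hasDerivAt_eq_zero hyz
    (fun x hx => (hder x hx).continuousAt.continuousWithinAt)
    (by rw [harc y hy fy, harc z hz fz]; ring)
    (fun x hx => hder x ⟨hx.1.le, hx.2.le⟩)
  refine ⟨c, hc, ?_⟩
  have hp := hneg c ⟨hc.1.le, hc.2.le⟩
  have he := eval_oneSubSqPoly_cos P c
  rw [mul_pow, hs2, one_mul, ← he] at hc0
  have hq : 0 < √((oneSubSqPoly P).eval (cos c)) := sqrt_pos.2 hp
  have hd : s * (derivPoly P).eval (cos c) = N * √((oneSubSqPoly P).eval (cos c)) := by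
    field_simp at hc0
    linarith
  have hd2 : (derivPoly P).eval (cos c) ^ 2 = N ^ 2 * (oneSubSqPoly P).eval (cos c) := by
    have := congrArg (· ^ 2) hd
    simp only [mul_pow, hs2, sq_sqrt hp.le] at this
    linarith
  simp [critPoly, hd2]

lemma critPoly_ne_zero {P : ℝ[X]} {N : ℕ} (h : P.eval 1 ^ 2 ≠ (N : ℝ) ^ 2) :
    critPoly P N ≠ 0 := by
  intro h0
  have := congrArg (Polynomial.eval 1) h0
  simp [critPoly, oneSubSqPoly, derivPoly] at this
  exact h (by linarith)

lemma natDegree_critPoly_le {P : ℝ[X]} {d : ℕ} (N : ℕ) (hd : P.natDegree ≤ d) :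
    (critPoly P N).natDegree ≤ 4 * d + 4 := by
  have h1 : (oneSubSqPoly P).natDegree ≤ 2 * d + 2 := by
    unfold oneSubSqPoly
    compute_degree
    omega
  have hd' : (Polynomial.derivative P).natDegree ≤ d - 1 :=
    (Polynomial.natDegree_derivative_le P).trans (by omega)
  have h2 : (derivPoly P).natDegree ≤ d + 1 := by
    rcases Nat.eq_zero_or_pos d with rfl | hpos
    · have : Polynomial.derivative P = 0 := Polynomial.derivative_of_natDegree_zero (by omega)
      simp only [derivPoly, this, mul_zero, sub_zero]
      compute_degree
      omega
    · unfold derivPoly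
      compute_degree
      omega
  unfold critPoly
  compute_degree
  omega

/-- The index `j` of the interval `[(j - 1/2) π / N, (j + 1/2) π / N)` containing `y`. -/
noncomputable def cellIndex (N : ℕ) (y : ℝ) : ℕ := ⌊N * y / π + 1 / 2⌋₊

lemma cellIndex_lt {N : ℕ} {y : ℝ} (hy : y ≤ π) : cellIndex N y < N + 1 := by
  have hpi := pi_pos
  rw [cellIndex, Nat.floor_lt' (by omega)]
  have : N * y / π ≤ N := by
    rw [div_le_iff₀ hpi]
    exact mul_le_mul_of_nonneg_left hy (by positivity)
  push_cast
  linarith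

lemma cellIndex_eq {N j : ℕ} {y : ℝ} (hy0 : 0 ≤ y) (h : |N * y - j * π| < π / 2) :
    cellIndex N y = j := by
  have hpi := pi_pos
  obtain ⟨h1, h2⟩ := abs_lt.1 h
  rw [cellIndex, Nat.floor_eq_iff (by positivity)]
  have e : N * y / π + 1 / 2 = (N * y + π / 2) / π := by field_simp
  rw [e, le_div_iff₀ hpi, div_lt_iff₀ hpi]
  constructor <;> linarith

lemma abs_sub_cellIndex_lt {N : ℕ} {y : ℝ} (hy0 : 0 ≤ y) (h : cos (N * y) ≠ 0) :
    |N * y - cellIndex N y * π| < π / 2 := by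
  have hpi := pi_pos
  have hpos : 0 ≤ N * y / π + 1 / 2 := by positivity
  have h1 : (cellIndex N y : ℝ) ≤ N * y / π + 1 / 2 := Nat.floor_le hpos
  have h2 : N * y / π + 1 / 2 < cellIndex N y + 1 := Nat.lt_floor_add_one _
  have e : N * y / π + 1 / 2 = (N * y + π / 2) / π := by field_simp
  rw [e, le_div_iff₀ hpi] at h1
  rw [e, div_lt_iff₀ hpi] at h2
  rw [abs_lt]
  refine ⟨lt_of_le_of_ne (by linarith) fun he => h ?_, by linarith⟩
  rw [← neg_one_pow_mul_eq_zero_iff (n := cellIndex N y), ← cos_sub_nat_mul_pi, ← he, cos_neg,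
    cos_pi_div_two]

open Finset in
lemma card_solutions_le {P : ℝ[X]} {N d : ℕ} (hN : 0 < N) (hd : P.natDegree ≤ d)
    (hP : P.eval 1 ^ 2 ≠ (N : ℝ) ^ 2) (Z : Finset ℝ)
    (hZ : ∀ y ∈ Z, y ∈ Set.Ioo 0 π ∧ sin (N * y) = sin y * P.eval (cos y)) :
    #Z ≤ 3 * (4 * d + 4) +
      ∑ j ∈ range (N + 1), if |sin (j * π / N) * P.eval (cos (j * π / N))| ≤ 1 then 1 else 0 := by
  classical
  have hpi := pi_pos
  have hN' : (0 : ℝ) < N := by exact_mod_cast hN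
  set B : Finset ℝ := (critPoly P N).roots.toFinset.image arccos with hB
  have hBcard : #B ≤ 4 * d + 4 :=
    card_image_le.trans <| (Multiset.toFinset_card_le _).trans <|
      (Polynomial.card_roots' _).trans (natDegree_critPoly_le N hd)
  have hBmem : ∀ x, 0 ≤ x → x ≤ π → (critPoly P N).eval (cos x) = 0 → x ∈ B := by
    intro x h0 h1 hx
    refine mem_image.2 ⟨cos x, ?_, arccos_cos h0 h1⟩
    simpa [critPoly_ne_zero hP] using hx
  have hBI : ∀ b ∈ B, b ≤ π := by
    intro b hb
    obtain ⟨c, -, rfl⟩ := mem_image.1 hb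
    exact arccos_le_pi c
  have hfib : ∀ j ∈ range (N + 1), #{y ∈ {y ∈ Z | cos (N * y) ≠ 0} | cellIndex N y = j} ≤
      2 * #{b ∈ B | cellIndex N b = j} +
        if |sin (j * π / N) * P.eval (cos (j * π / N))| ≤ 1 then 1 else 0 := by
    intro j hj
    have hjN : (j : ℝ) ≤ N := by exact_mod_cast (mem_range_succ_iff.1 hj)
    have hcell : ∀ y ∈ ({y ∈ {y ∈ Z | cos (N * y) ≠ 0} | cellIndex N y = j} : Finset ℝ),
        y ∈ Set.Ioo 0 π ∧ sin (N * y) = sin y * P.eval (cos y) ∧ |N * y - j * π| < π / 2 := by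
      intro y hy
      simp only [mem_filter] at hy
      obtain ⟨⟨h1, h2⟩, rfl⟩ := hy
      exact ⟨(hZ y h1).1, (hZ y h1).2, abs_sub_cellIndex_lt (hZ y h1).1.1.le h2⟩
    have hle : #{y ∈ {y ∈ Z | cos (N * y) ≠ 0} | cellIndex N y = j} ≤
        #{b ∈ B | cellIndex N b = j} + 1 := by
      refine card_le_of_interleaved fun y hy z hz hyz _ => ?_
      obtain ⟨iy, fy, cy⟩ := hcell y hy
      obtain ⟨iz, fz, cz⟩ := hcell z hz
      obtain ⟨x, hx, hx0⟩ := exists_critPoly_root_between hyz cy cz fy fz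
      have hxpos : 0 ≤ x := iy.1.le.trans hx.1.le
      refine ⟨x, mem_filter.2 ⟨hBmem x hxpos (hx.2.le.trans iz.2.le) hx0,
        cellIndex_eq hxpos ?_⟩, hx.1, hx.2⟩
      have a1 := mul_lt_mul_of_pos_left hx.1 hN'
      have a2 := mul_lt_mul_of_pos_left hx.2 hN'
      rw [abs_lt] at cy cz ⊢
      constructor <;> linarith
    split_ifs with hgood
    · omega
    rcases Nat.eq_zero_or_pos (#{b ∈ B | cellIndex N b = j}) with h0 | h0
    · rw [h0, mul_zero, zero_add, Nat.le_zero, card_eq_zero]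
      by_contra hne
      obtain ⟨y, hy⟩ := nonempty_iff_ne_empty.2 hne
      obtain ⟨iy, fy, cy⟩ := hcell y hy
      have py := oneSubSqPoly_pos_of_cell cy fy
      set c : ℝ := j * π / N with hc
      have hNc : N * c = j * π := by rw [hc]; field_simp
      have hc0 : 0 ≤ c := by positivity
      have hcpi : c ≤ π := by
        rw [hc, div_le_iff₀ hN', mul_comm]
        exact mul_le_mul_of_nonneg_left hjN hpi.le
      have pc : (oneSubSqPoly P).eval (cos c) ≤ 0 := by
        rw [eval_oneSubSqPoly_cos, sub_nonpos, one_le_sq_iff_one_le_abs]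
        exact (not_le.1 hgood).le
      obtain ⟨x, hx0, hxpi, hxc, hx⟩ : ∃ x, 0 ≤ x ∧ x ≤ π ∧ |N * x - j * π| < π / 2 ∧
          (critPoly P N).eval (cos x) = 0 := by
        rw [abs_lt] at cy
        rcases le_total y c with hyc | hyc
        · obtain ⟨x, hx, -, hx0⟩ := exists_critPoly_eq_zero_of_not_pos N hyc (.inl py)
            ⟨c, ⟨hyc, le_rfl⟩, pc⟩
          refine ⟨x, iy.1.le.trans hx.1, hx.2.trans hcpi, ?_, hx0⟩
          have a1 := mul_le_mul_of_nonneg_left hx.1 hN'.le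
          have a2 := mul_le_mul_of_nonneg_left hx.2 hN'.le
          rw [abs_lt]
          constructor <;> linarith
        · obtain ⟨x, hx, -, hx0⟩ := exists_critPoly_eq_zero_of_not_pos N hyc (.inr py)
            ⟨c, ⟨le_rfl, hyc⟩, pc⟩
          refine ⟨x, hc0.trans hx.1, hx.2.trans iy.2.le, ?_, hx0⟩
          have a1 := mul_le_mul_of_nonneg_left hx.1 hN'.le
          have a2 := mul_le_mul_of_nonneg_left hx.2 hN'.le
          rw [abs_lt]
          constructor <;> linarith
      have hmem : x ∈ ({b ∈ B | cellIndex N b = j} : Finset ℝ) :=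
        mem_filter.2 ⟨hBmem x hx0 hxpi hx, cellIndex_eq hx0 hxc⟩
      rw [card_eq_zero.1 h0] at hmem
      simp at hmem
    · omega
  have h1 : #{y ∈ Z | cos (N * y) = 0} ≤ #B := by
    refine card_le_card fun y hy => ?_
    obtain ⟨hyZ, hy0⟩ := mem_filter.1 hy
    obtain ⟨iy, fy⟩ := hZ y hyZ
    refine hBmem y iy.1.le iy.2.le ?_
    have : (oneSubSqPoly P).eval (cos y) = 0 := by
      rw [eval_oneSubSqPoly_cos, ← fy, sin_sq, hy0]; simp
    simp [critPoly, this]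
  have h2 : #{y ∈ Z | cos (N * y) ≠ 0} ≤ 2 * #B +
      ∑ j ∈ range (N + 1), if |sin (j * π / N) * P.eval (cos (j * π / N))| ≤ 1 then 1 else 0 := by
    rw [card_eq_sum_card_fiberwise (f := cellIndex N) (t := range (N + 1))
      (fun y hy => mem_coe.2 <| mem_range.2 <|
        cellIndex_lt (hZ y (mem_filter.1 (mem_coe.1 hy)).1).1.2.le),
      card_eq_sum_card_fiberwise (s := B) (f := cellIndex N) (t := range (N + 1))
      (fun y hy => mem_coe.2 <| mem_range.2 <| cellIndex_lt (hBI y (mem_coe.1 hy))),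
      mul_sum, ← sum_add_distrib]
    exact sum_le_sum hfib
  have h3 := card_filter_add_card_filter_not (s := Z) (fun y => cos (N * y) = 0)
  simp only [← ne_eq] at h3
  omega

open Finset in
/-- **Littlewood–Offord inequality** (Erdős): a random subset sum in which the coefficients indexed
by `T` have absolute value at least `δ` rarely lies in a given half-open interval of length `δ`. -/
lemma card_subset_sum_mem_interval_le {ι : Type*} [Fintype ι] [DecidableEq ι] (a : ι → ℝ)
    (T : Finset ι) {δ : ℝ} (hδ : 0 < δ) (ha : ∀ i ∈ T, δ ≤ |a i|) (u : ℝ) :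
    #{e : ι → Bool | u ≤ ∑ i, (if e i then (1 : ℝ) else 0) * a i ∧
        ∑ i, (if e i then (1 : ℝ) else 0) * a i < u + δ} ≤
      (#T).choose (#T / 2) * 2 ^ (Fintype.card ι - #T) := by
  classical
  set S : (ι → Bool) → ℝ := fun e => ∑ i, (if e i then (1 : ℝ) else 0) * a i with hS
  set g : (ι → Bool) → Finset T := fun e => {i : T | (e i = true) ↔ 0 < a i} with hg
  have hstep : ∀ e e' : ι → Bool, (∀ i ∉ T, e i = e' i) → g e ⊆ g e' → e ≠ e' →
      S e + δ ≤ S e' := by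
    intro e e' hout hsub hne
    have hterm : ∀ i, e i ≠ e' i → δ ≤ (if e' i then (1 : ℝ) else 0) * a i -
        (if e i then (1 : ℝ) else 0) * a i := by
      intro i hi
      have hiT : i ∈ T := by
        by_contra h
        exact hi (hout i h)
      have hs : ((e i = true) ↔ 0 < a i) → ((e' i = true) ↔ 0 < a i) := by
        have := @hsub ⟨i, hiT⟩
        simpa [hg] using this
      have hai := ha i hiT
      rcases lt_or_ge 0 (a i) with hp | hp
      · rw [abs_of_pos hp] at hai
        cases he : e i <;> cases he' : e' i <;> simp_all
      · rw [abs_of_nonpos hp] at hai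
        have hp' := not_lt.2 hp
        cases he : e i <;> cases he' : e' i <;> simp_all
    obtain ⟨i, hi⟩ := Function.ne_iff.1 hne
    have hle : δ ≤ ∑ i, ((if e' i then (1 : ℝ) else 0) * a i -
        (if e i then (1 : ℝ) else 0) * a i) := by
      refine (hterm i hi).trans (single_le_sum (f := fun i => (if e' i then (1 : ℝ) else 0) * a i -
        (if e i then (1 : ℝ) else 0) * a i) (fun j _ => ?_) (mem_univ i))
      by_cases hj : e j = e' j
      · simp [hj]
      · exact hδ.le.trans (hterm j hj)
    rw [sum_sub_distrib] at hle
    linarith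
  have hcard : Fintype.card ι - #T = Fintype.card {i // i ∉ T} := by
    rw [Fintype.card_subtype_compl (fun i => i ∈ T), Fintype.card_coe]
  have h2 : 2 ^ (Fintype.card ι - #T) = #(univ : Finset ({i // i ∉ T} → Bool)) := by
    rw [hcard, card_univ, Fintype.card_fun, Fintype.card_bool]
  rw [h2]
  refine card_le_mul_card_image_of_maps_to (f := fun e (i : {i // i ∉ T}) => e i)
    (fun _ _ => mem_univ _) _ fun b _ => ?_
  set E := ({e ∈ ({e : ι → Bool | u ≤ S e ∧ S e < u + δ} : Finset _) |
    (fun i : {i // i ∉ T} => e i) = b}) with hE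
  have hmem : ∀ e ∈ E, (u ≤ S e ∧ S e < u + δ) ∧ ∀ i (hi : i ∉ T), e i = b ⟨i, hi⟩ := by
    intro e he
    simp only [hE, mem_filter, mem_univ, true_and] at he
    exact ⟨he.1, fun i hi => congrFun he.2 ⟨i, hi⟩⟩
  have hno : ∀ e ∈ E, ∀ e' ∈ E, g e ⊆ g e' → e = e' := by
    intro e he e' he' hsub
    by_contra hne
    have := hstep e e' (fun i hi => ((hmem e he).2 i hi).trans ((hmem e' he').2 i hi).symm) hsub hne
    linarith [(hmem e he).1.1, (hmem e' he').1.2]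
  have hinj : Set.InjOn g E := fun e he e' he' h => hno e he e' he' h.subset
  rw [← card_image_of_injOn hinj]
  have hanti : IsAntichain (· ⊆ ·) ((E.image g : Finset (Finset T)) : Set (Finset T)) := by
    intro s hs t ht hne hst
    obtain ⟨e, he, rfl⟩ := mem_image.1 (mem_coe.1 hs)
    obtain ⟨e', he', rfl⟩ := mem_image.1 (mem_coe.1 ht)
    exact hne (congrArg g (hno e he e' he' hst))
  simpa using hanti.sperner

lemma half_le_abs_cos_or (x : ℝ) : 1 / 2 ≤ |cos x| ∨ 1 / 2 ≤ |cos (2 * x)| := by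
  by_contra! h
  obtain ⟨h1, h2⟩ := h
  rw [cos_two_mul] at h2
  have := sq_lt_sq' (abs_lt.1 h1).1 (abs_lt.1 h1).2
  have := (abs_lt.1 h2).1
  linarith

open Finset in
lemma exists_finset_half_le_abs_cos (x : ℝ) {m r : ℕ} (h : 8 * r ≤ m) :
    ∃ T : Finset (Fin (m + 1)), #T = 2 * r ∧ ∀ k ∈ T, 1 / 2 ≤ |cos ((k : ℕ) * x)| := by
  have hex : ∀ i : Fin (2 * r), ∃ k : Fin (m + 1),
      ((k : ℕ) = 2 * i + 1 ∨ (k : ℕ) = 2 * (2 * i + 1)) ∧ 1 / 2 ≤ |cos ((k : ℕ) * x)| := by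
    intro i
    have hi := i.2
    rcases half_le_abs_cos_or ((2 * (i : ℕ) + 1 : ℕ) * x) with h1 | h1
    · exact ⟨⟨2 * i + 1, by omega⟩, .inl rfl, h1⟩
    · refine ⟨⟨2 * (2 * i + 1), by omega⟩, .inr rfl, ?_⟩
      rw [← mul_assoc] at h1
      exact_mod_cast h1
  choose k hk hcos using hex
  have hinj : Function.Injective k := by
    intro i j hij
    have hi := hk i
    have hj := hk j
    rw [hij] at hi
    ext
    omega
  refine ⟨univ.image k, ?_, ?_⟩
  · rw [card_image_of_injective _ hinj, card_univ, Fintype.card_fin]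
  · intro j hj
    obtain ⟨i, -, rfl⟩ := mem_image.1 hj
    exact hcos i

lemma two_mul_add_one_mul_centralBinom_sq_le (r : ℕ) :
    (2 * r + 1) * r.centralBinom ^ 2 ≤ 4 ^ (2 * r) := by
  induction r with
  | zero => simp
  | succ r ih =>
    have h := Nat.succ_mul_centralBinom_succ r
    refine Nat.le_of_mul_le_mul_left ?_ (Nat.pow_pos (n := 2) (Nat.succ_pos r))
    calc (r + 1) ^ 2 * ((2 * (r + 1) + 1) * (r + 1).centralBinom ^ 2)
        = (2 * r + 3) * ((r + 1) * (r + 1).centralBinom) ^ 2 := by ring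
      _ = 4 * ((2 * r + 3) * (2 * r + 1)) * ((2 * r + 1) * r.centralBinom ^ 2) := by
          rw [h]; ring
      _ ≤ 4 * (4 * (r + 1) ^ 2) * 4 ^ (2 * r) := by
          have h' : (2 * r + 3) * (2 * r + 1) ≤ 4 * (r + 1) ^ 2 := by nlinarith
          gcongr
      _ = (r + 1) ^ 2 * 4 ^ (2 * (r + 1)) := by ring

open Finset in
lemma card_cos_sum_mem_interval_le (m : ℕ) (hm : 0 < m) (x u : ℝ) :
    (#{e : Fin (m + 1) → Bool |
        u ≤ ∑ k : Fin (m + 1), (if e k then (1 : ℝ) else 0) * cos ((k : ℕ) * x) ∧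
        ∑ k : Fin (m + 1), (if e k then (1 : ℝ) else 0) * cos ((k : ℕ) * x) < u + 1 / 2} : ℝ) ≤
      3 / √m * 2 ^ (m + 1) := by
  obtain ⟨T, hT, hcos⟩ := exists_finset_half_le_abs_cos x (Nat.mul_div_le m 8)
  set r := m / 8 with hr
  have h := card_subset_sum_mem_interval_le (fun k : Fin (m + 1) => cos ((k : ℕ) * x)) T
    one_half_pos hcos u
  rw [hT, Nat.mul_div_cancel_left r two_pos, ← Nat.centralBinom_eq_two_mul_choose,
    Fintype.card_fin] at h
  have hm' : (0 : ℝ) < √m := sqrt_pos.2 (by exact_mod_cast hm)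
  have hb : (r.centralBinom : ℝ) ≤ 3 / √m * 2 ^ (2 * r) := by
    refine abs_le_of_sq_le_sq' ?_ (by positivity) |>.2
    rw [mul_pow, div_pow, sq_sqrt (Nat.cast_nonneg m), ← pow_mul, mul_comm (2 * r) 2, pow_mul]
    have h1 : ((2 * r + 1) * r.centralBinom ^ 2 : ℝ) ≤ 4 ^ (2 * r) := by
      exact_mod_cast two_mul_add_one_mul_centralBinom_sq_le r
    have h2 : (m : ℝ) ≤ 8 * (2 * r + 1) := by
      have : m ≤ 8 * (2 * r + 1) := by omega
      exact_mod_cast this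
    have hmp : (0 : ℝ) < m := by exact_mod_cast hm
    rw [div_mul_eq_mul_div, le_div_iff₀ hmp]
    norm_num
    have h3 : (r.centralBinom : ℝ) ^ 2 * m ≤ r.centralBinom ^ 2 * (8 * (2 * r + 1)) := by gcongr
    nlinarith [pow_pos (four_pos (α := ℝ)) (2 * r)]
  have h2r : 2 * r + (m + 1 - 2 * r) = m + 1 := by omega
  calc _ ≤ ((r.centralBinom * 2 ^ (m + 1 - 2 * r) : ℕ) : ℝ) := by exact_mod_cast h
    _ ≤ 3 / √m * 2 ^ (2 * r) * 2 ^ (m + 1 - 2 * r) := by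
        push_cast
        gcongr
    _ = _ := by rw [mul_assoc, ← pow_add, h2r]

open Finset in
lemma card_abs_cos_sum_sub_half_le (m : ℕ) (hm : 0 < m) (x : ℝ) {t : ℝ} (ht : 1 / 2 ≤ t) :
    (#{e : Fin (m + 1) → Bool |
        |∑ k : Fin (m + 1), (if e k then (1 : ℝ) else 0) * cos ((k : ℕ) * x) - 1 / 2| ≤ t} : ℝ) ≤
      18 * t / √m * 2 ^ (m + 1) := by
  set S : (Fin (m + 1) → Bool) → ℝ :=
    fun e => ∑ k : Fin (m + 1), (if e k then (1 : ℝ) else 0) * cos ((k : ℕ) * x) with hS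
  have hmaps : ∀ e ∈ ({e : Fin (m + 1) → Bool | |S e - 1 / 2| ≤ t} : Finset _),
      ⌊2 * (S e - 1 / 2 + t)⌋₊ ∈ range (⌊4 * t⌋₊ + 1) := by
    intro e he
    have := abs_le.1 (mem_filter.1 he).2
    exact mem_range_succ_iff.2 (Nat.floor_le_floor (by linarith))
  have hfib : ∀ i ∈ range (⌊4 * t⌋₊ + 1),
      (#{e ∈ ({e : Fin (m + 1) → Bool | |S e - 1 / 2| ≤ t} : Finset _) |
        ⌊2 * (S e - 1 / 2 + t)⌋₊ = i} : ℝ) ≤ 3 / √m * 2 ^ (m + 1) := by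
    intro i _
    refine le_trans ?_ (card_cos_sum_mem_interval_le m hm x (1 / 2 - t + i / 2))
    refine Nat.cast_le.2 (card_le_card fun e he => ?_)
    simp only [mem_filter, mem_univ, true_and] at he ⊢
    obtain ⟨h1, h2⟩ := he
    have := abs_le.1 h1
    rw [Nat.floor_eq_iff (by linarith)] at h2
    change _ ≤ S e ∧ S e < _
    constructor <;> linarith
  rw [card_eq_sum_card_fiberwise hmaps]
  push_cast
  refine (sum_le_sum hfib).trans ?_
  rw [sum_const, card_range, nsmul_eq_mul]
  have h4 : ((⌊4 * t⌋₊ + 1 : ℕ) : ℝ) ≤ 6 * t := by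
    have := Nat.floor_le (a := 4 * t) (by linarith)
    push_cast
    linarith
  calc _ ≤ 6 * t * (3 / √m * 2 ^ (m + 1)) := by gcongr
    _ = _ := by ring

/-- A majorant for the probability that the rescaled random polynomial is small at the
`j`-th extremum of the oscillating term. -/
noncomputable def smallBound (A : ℝ) (j : ℕ) : ℝ := if j = 0 then 1 else min 1 (A / j)

lemma smallBound_nonneg {A : ℝ} (hA : 0 ≤ A) (j : ℕ) : 0 ≤ smallBound A j := by
  unfold smallBound
  split_ifs
  · exact zero_le_one
  · exact le_min zero_le_one (by positivity)

open Finset in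
lemma sum_smallBound_le {A : ℝ} (hA : 0 ≤ A) {J N : ℕ} (hJ : J ≤ N) :
    ∑ j ∈ range (N + 1), smallBound A j ≤ 1 + J + A * (1 + log N - log (J + 1)) := by
  have hsum : ∀ M, (harmonic M : ℝ) = ∑ j ∈ range M, ((j : ℝ) + 1)⁻¹ := by
    intro M
    simp [harmonic]
  have h1 : ∑ j ∈ range (N + 1), smallBound A j ≤ 1 + J + A * (harmonic N - harmonic J) := by
    induction N, hJ using Nat.le_induction with
    | base =>
      have : ∀ j ∈ range (J + 1), smallBound A j ≤ 1 := by
        intro j _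
        unfold smallBound
        split_ifs
        · exact le_rfl
        · exact min_le_left _ _
      refine (sum_le_sum this).trans ?_
      simp
      linarith
    | succ N hJN ih =>
      rw [sum_range_succ]
      have h2 : smallBound A (N + 1) ≤ A * ((N : ℝ) + 1)⁻¹ := by
        simp only [smallBound, Nat.add_eq_zero_iff, one_ne_zero, and_false, if_false]
        refine (min_le_right _ _).trans_eq ?_
        push_cast
        rw [div_eq_mul_inv]
      have h3 : (harmonic (N + 1) : ℝ) = harmonic N + ((N : ℝ) + 1)⁻¹ := by
        rw [hsum, hsum, sum_range_succ]
      rw [h3]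
      linarith
  refine h1.trans ?_
  have h2 := harmonic_le_one_add_log N
  have h3 := log_add_one_le_harmonic J
  push_cast at h3
  gcongr

lemma inv_sin_le {N j : ℕ} (hj : 0 < j) (hjN : 2 * j ≤ N) :
    1 / sin (j * π / N) ≤ N / (2 * j) := by
  have hpi := pi_pos
  have hj' : (0 : ℝ) < j := by exact_mod_cast hj
  have hN : (2 * j : ℝ) ≤ N := by exact_mod_cast hjN
  have hN' : (0 : ℝ) < N := by linarith
  have h : 2 / π * (j * π / N) ≤ sin (j * π / N) := by
    refine mul_le_sin (by positivity) ?_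
    rw [div_le_div_iff₀ hN' two_pos]
    nlinarith
  have e : 2 / π * (j * π / N) = 2 * j / N := by field_simp
  rw [e] at h
  have h0 : 0 < 2 * j / (N : ℝ) := by positivity
  calc 1 / sin (j * π / N) ≤ 1 / (2 * j / N) := one_div_le_one_div_of_le h0 h
    _ = _ := by rw [one_div_div]

open Finset in
lemma card_small_at_extremum_le {m N j : ℕ} (hm : 0 < m) (hj : j ≤ N) :
    (#{e : Fin (m + 1) → Bool | |sin (j * π / N) *
        (2 * ∑ k : Fin (m + 1), (if e k then (1 : ℝ) else 0) *
          cos ((k : ℕ) * (2 * (j * π / N))) - 1)| ≤ 1} : ℝ) ≤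
      (smallBound (9 * N / (2 * √m)) j + smallBound (9 * N / (2 * √m)) (N - j)) * 2 ^ (m + 1) := by
  have hA : 0 ≤ 9 * (N : ℝ) / (2 * √m) := by positivity
  have hpow : (0 : ℝ) < 2 ^ (m + 1) := by positivity
  set G : Finset (Fin (m + 1) → Bool) := {e | |sin (j * π / N) *
        (2 * ∑ k : Fin (m + 1), (if e k then (1 : ℝ) else 0) *
          cos ((k : ℕ) * (2 * (j * π / N))) - 1)| ≤ 1} with hG
  have htriv : (#G : ℝ) ≤ 1 * 2 ^ (m + 1) := by
    have : #G ≤ 2 ^ (m + 1) := (card_le_univ _).trans (by simp)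
    rw [one_mul]
    exact_mod_cast this
  have hbound : ∀ i : ℕ, 0 < i → 2 * i ≤ N → sin (i * π / N) = sin (j * π / N) →
      (#G : ℝ) ≤ smallBound (9 * N / (2 * √m)) i * 2 ^ (m + 1) := by
    intro i hi hiN hs
    have hpi := pi_pos
    have hN' : (2 * i : ℝ) ≤ N := by exact_mod_cast hiN
    have hi' : (0 : ℝ) < i := by exact_mod_cast hi
    have hinv := inv_sin_le hi hiN
    rw [hs] at hinv
    have hsin : 0 < sin (j * π / N) := by
      rw [← hs]
      refine sin_pos_of_pos_of_lt_pi (div_pos (by positivity) (by linarith)) ?_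
      rw [div_lt_iff₀ (by linarith)]
      nlinarith
    have hcard : (#G : ℝ) ≤ 18 * (1 / (2 * sin (j * π / N))) / √m * 2 ^ (m + 1) := by
      refine le_trans ?_ (card_abs_cos_sum_sub_half_le m hm (2 * (j * π / N)) ?_)
      · refine Nat.cast_le.2 (card_le_card fun e he => ?_)
        simp only [hG, mem_filter, mem_univ, true_and] at he ⊢
        rw [abs_mul, abs_of_pos hsin] at he
        rw [le_div_iff₀ (by positivity)]
        have hscale : ∀ s : ℝ, |s - 1 / 2| * (2 * sin (j * π / N)) =
            sin (j * π / N) * |2 * s - 1| := by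
          intro s
          have : 2 * s - 1 = 2 * (s - 1 / 2) := by ring
          rw [this, abs_mul, abs_two]
          ring
        exact (hscale _).trans_le he
      · rw [div_le_div_iff₀ two_pos (by positivity)]
        linarith [sin_le_one (j * π / N)]
    rw [smallBound, if_neg hi.ne', min_mul_of_nonneg _ _ hpow.le]
    refine le_min htriv (hcard.trans (mul_le_mul_of_nonneg_right ?_ hpow.le))
    have e1 : 18 * (1 / (2 * sin (j * π / N))) / √m = 9 / √m * (1 / sin (j * π / N)) := by
      field_simp; norm_num
    have e2 : 9 * N / (2 * √m) / i = 9 / √m * (N / (2 * i)) := by field_simp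
    rw [e1, e2]
    gcongr
  have hn1 := smallBound_nonneg hA j
  have hn2 := smallBound_nonneg hA (N - j)
  rcases Nat.eq_zero_or_pos j with rfl | hj0
  · refine htriv.trans ?_
    gcongr
    have : smallBound (9 * N / (2 * √m)) 0 = 1 := if_pos rfl
    linarith
  rcases Nat.eq_zero_or_pos (N - j) with h0 | h0
  · refine htriv.trans ?_
    gcongr
    have : smallBound (9 * N / (2 * √m)) (N - j) = 1 := if_pos h0
    linarith
  rcases le_or_gt (2 * j) N with h | h
  · refine (hbound j hj0 h rfl).trans ?_
    gcongr
    linarith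
  · refine (hbound (N - j) h0 (by omega) ?_).trans ?_
    · rw [← sin_pi_sub (j * π / N), Nat.cast_sub hj]
      congr 1
      have : (N : ℝ) ≠ 0 := by
        have : 0 < N := by omega
        positivity
      field_simp
    · gcongr
      linarith

/-- The polynomial `P` such that `2 sin y F(2y) = sin ((2n+1) y) - sin y P (cos y)`. -/
noncomputable def chebPoly (m : ℕ) (e : Fin (m + 1) → Bool) : ℝ[X] :=
  ∑ k : Fin (m + 1), .C (2 * if e k then (1 : ℝ) else 0) *
    Polynomial.Chebyshev.T ℝ ((2 * (k : ℕ) : ℕ) : ℤ) - 1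

lemma natDegree_chebPoly_le (m : ℕ) (e : Fin (m + 1) → Bool) :
    (chebPoly m e).natDegree ≤ 2 * m := by
  refine (Polynomial.natDegree_sub_le _ _).trans (max_le ?_ (by simp))
  refine Polynomial.natDegree_sum_le_of_forall_le _ _ fun k _ => ?_
  refine (Polynomial.natDegree_C_mul_le _ _).trans ?_
  rw [Polynomial.Chebyshev.natDegree_T, Int.natAbs_natCast]
  omega

lemma eval_chebPoly_cos (m : ℕ) (e : Fin (m + 1) → Bool) (y : ℝ) :
    (chebPoly m e).eval (cos y) =
      2 * ∑ k : Fin (m + 1), (if e k then (1 : ℝ) else 0) * cos ((k : ℕ) * (2 * y)) - 1 := by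
  simp only [chebPoly, Polynomial.eval_sub, Polynomial.eval_finsetSum, Polynomial.eval_mul,
    Polynomial.eval_C, Polynomial.eval_one, Polynomial.Chebyshev.T_real_cos, Finset.mul_sum]
  congr 1
  refine Finset.sum_congr rfl fun k _ => ?_
  push_cast
  ring_nf

lemma two_sin_mul_Dker (n : ℕ) (y : ℝ) :
    2 * sin y * Dker n (2 * y) = sin y + sin ((2 * n + 1 : ℕ) * y) := by
  unfold Dker
  induction n with
  | zero => simp; ring
  | succ n ih =>
    rw [Finset.sum_range_succ, mul_add, ih]
    have h1 : ((2 * (n + 1) + 1 : ℕ) : ℝ) * y = (n + 1 : ℕ) * (2 * y) + y := by push_cast; ring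
    have h2 : ((2 * n + 1 : ℕ) : ℝ) * y = (n + 1 : ℕ) * (2 * y) - y := by push_cast; ring
    rw [h1, h2, sin_add, sin_sub]
    ring

lemma sin_eq_of_F_eq_zero {n m : ℕ} {e : Fin (m + 1) → Bool} {y : ℝ} (h : F n m e (2 * y) = 0) :
    sin ((2 * n + 1 : ℕ) * y) = sin y * (chebPoly m e).eval (cos y) := by
  rw [eval_chebPoly_cos]
  have h1 := two_sin_mul_Dker n y
  simp only [F] at h
  rw [sub_eq_zero.1 h] at h1
  linarith

lemma F_eq_zero_of_eval_chebPoly {n m : ℕ} (hn : 0 < n) (hmn : m ≤ n) {e : Fin (m + 1) → Bool}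
    (h : (chebPoly m e).eval 1 ^ 2 = ((2 * n + 1 : ℕ) : ℝ) ^ 2) (x : ℝ) : F n m e x = 0 := by
  have hev := eval_chebPoly_cos m e 0
  simp only [cos_zero, mul_zero, mul_one] at hev
  set s : ℝ := ∑ k : Fin (m + 1), (if e k then (1 : ℝ) else 0) with hs
  have hs0 : 0 ≤ s := Finset.sum_nonneg fun k _ => by split_ifs <;> norm_num
  have hdef : (m : ℝ) + 1 - s = ∑ k : Fin (m + 1), (1 - if e k then (1 : ℝ) else 0) := by
    rw [Finset.sum_sub_distrib, hs]
    simp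
  have hterm : ∀ k ∈ (Finset.univ : Finset (Fin (m + 1))),
      0 ≤ (1 - if e k then (1 : ℝ) else 0) := fun k _ => by split_ifs <;> norm_num
  have hs1 : 0 ≤ (m : ℝ) + 1 - s := hdef ▸ Finset.sum_nonneg hterm
  have hmn' : (m : ℝ) ≤ n := by exact_mod_cast hmn
  rw [hev] at h
  push_cast at h
  have hm0 : (0 : ℝ) ≤ m := m.cast_nonneg
  have hsn : s = n + 1 := by
    rcases sq_eq_sq_iff_eq_or_eq_neg.1 h with h | h
    · linarith
    · have hn' : (0 : ℝ) < n := by exact_mod_cast hn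
      linarith
  have hnm : n = m := by
    have : (n : ℝ) = m := by linarith
    exact_mod_cast this
  subst hnm
  have hall : ∀ k, (1 - if e k then (1 : ℝ) else 0) = 0 := by
    have : ∑ k : Fin (n + 1), (1 - if e k then (1 : ℝ) else 0) = 0 := by linarith
    exact fun k => (Finset.sum_eq_zero_iff_of_nonneg hterm).1 this k (Finset.mem_univ k)
  have hone : ∀ k, (if e k then (1 : ℝ) else 0) = 1 := fun k => by linarith [hall k]
  simp only [F, Dker, hone, one_mul, Finset.sum_range, sub_self]

open Finset in
lemma zeros_F_le {n m : ℕ} (hn : 0 < n) (hmn : m ≤ n) (e : Fin (m + 1) → Bool) :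
    zeros (F n m e) (Set.Icc 0 (2 * π)) ≤ 24 * m + 14 +
      ∑ j ∈ range (2 * n + 1 + 1), if |sin (j * π / (2 * n + 1 : ℕ)) *
        (2 * ∑ k : Fin (m + 1), (if e k then (1 : ℝ) else 0) *
          cos ((k : ℕ) * (2 * (j * π / (2 * n + 1 : ℕ)))) - 1)| ≤ 1 then 1 else 0 := by
  classical
  unfold zeros
  by_cases hfin : {x ∈ Set.Icc 0 (2 * π) | F n m e x = 0}.Finite
  swap
  · rw [Set.Infinite.ncard hfin]
    exact Nat.zero_le _
  have hP : (chebPoly m e).eval 1 ^ 2 ≠ ((2 * n + 1 : ℕ) : ℝ) ^ 2 := by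
    intro h
    refine (Set.Icc_infinite two_pi_pos) (hfin.subset fun x hx => ⟨hx, ?_⟩)
    exact F_eq_zero_of_eval_chebPoly hn hmn h x
  rw [Set.ncard_eq_toFinset_card _ hfin]
  set Z := hfin.toFinset with hZ
  set Y : Finset ℝ := {y ∈ Z.image (· / 2) | 0 < y ∧ y < π} with hY
  have hYsol : ∀ y ∈ Y, y ∈ Set.Ioo 0 π ∧
      sin ((2 * n + 1 : ℕ) * y) = sin y * (chebPoly m e).eval (cos y) := by
    intro y hy
    obtain ⟨hy, hyI⟩ := mem_filter.1 hy
    obtain ⟨x, hx, rfl⟩ := mem_image.1 hy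
    refine ⟨hyI, sin_eq_of_F_eq_zero ?_⟩
    rw [mul_div_cancel₀ x two_ne_zero]
    exact (hfin.mem_toFinset.1 hx).2
  have hcard := card_solutions_le (Nat.succ_pos (2 * n)) (natDegree_chebPoly_le m e) hP Y hYsol
  simp only [eval_chebPoly_cos, Nat.succ_eq_add_one] at hcard
  have hZY : #Z ≤ #Y + 2 := by
    have hsub : Z ⊆ insert 0 (insert (2 * π) (Y.image (2 * ·))) := by
      intro x hx
      obtain ⟨⟨h0, h1⟩, -⟩ := hfin.mem_toFinset.1 hx
      rcases h0.eq_or_lt with rfl | h0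
      · simp
      rcases h1.eq_or_lt with rfl | h1
      · simp
      refine mem_insert_of_mem (mem_insert_of_mem (mem_image.2 ⟨x / 2, ?_, by ring⟩))
      exact mem_filter.2 ⟨mem_image_of_mem _ hx, by linarith, by linarith⟩
    have h1 := card_le_card hsub
    have h2 := card_insert_le 0 (insert (2 * π) (Y.image (2 * ·)))
    have h3 := card_insert_le (2 * π) (Y.image (2 * ·))
    have h4 := card_image_le (s := Y) (f := (2 * ·))
    omega
  omega

/-- There is an absolute constant `C > 0` such that for all `n ≥ m ≥ 2`, if
`f ~ F_{n,m}` then `E Z(f) ≤ C (n log m / √m + m)`, where the expectation is the average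
over all `2^(m+1)` outcomes of the Bernoulli variables. -/
theorem stmt1 :
    ∃ C : ℝ, 0 < C ∧ ∀ m n : ℕ, 2 ≤ m → m ≤ n →
      (∑ e : Fin (m + 1) → Bool, (zeros (F n m e) (Set.Icc 0 (2 * π)) : ℝ)) / 2 ^ (m + 1) ≤
        C * ((n : ℝ) * Real.log m / Real.sqrt m + m) := by
  refine ⟨100, by norm_num, fun m n hm hmn => ?_⟩
  have hm' : (2 : ℝ) ≤ m := by exact_mod_cast hm
  have hmn' : (m : ℝ) ≤ n := by exact_mod_cast hmn
  have hpow : (0 : ℝ) < 2 ^ (m + 1) := by positivity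
  have hsq : 1 < √(m : ℝ) := by
    rw [lt_sqrt zero_le_one]
    linarith
  have hsq0 : 0 < √(m : ℝ) := by linarith
  set N := 2 * n + 1 with hN
  have hNn : (N : ℝ) ≤ 3 * n := by
    rw [hN]
    push_cast
    linarith
  have hN0 : (0 : ℝ) < N := by
    rw [hN]
    positivity
  set A : ℝ := 9 * N / (2 * √m) with hA
  have hA0 : 0 ≤ A := by positivity
  set Q := ∑ j ∈ Finset.range (N + 1), smallBound A j with hQ
  have hmain : ∑ e : Fin (m + 1) → Bool, (zeros (F n m e) (Set.Icc 0 (2 * π)) : ℝ) ≤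
      (24 * m + 14 + 2 * Q) * 2 ^ (m + 1) := by
    calc ∑ e : Fin (m + 1) → Bool, (zeros (F n m e) (Set.Icc 0 (2 * π)) : ℝ)
        ≤ ∑ e : Fin (m + 1) → Bool, ((24 * m + 14 : ℝ) +
          ∑ j ∈ Finset.range (N + 1), if |sin (j * π / N) *
            (2 * ∑ k : Fin (m + 1), (if e k then (1 : ℝ) else 0) *
              cos ((k : ℕ) * (2 * (j * π / N))) - 1)| ≤ 1 then 1 else 0) :=
          Finset.sum_le_sum fun e _ => by exact_mod_cast zeros_F_le (by omega) hmn e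
      _ = (24 * m + 14) * 2 ^ (m + 1) + ∑ j ∈ Finset.range (N + 1),
          ((Finset.univ.filter fun e : Fin (m + 1) → Bool => |sin (j * π / N) *
            (2 * ∑ k : Fin (m + 1), (if e k then (1 : ℝ) else 0) *
              cos ((k : ℕ) * (2 * (j * π / N))) - 1)| ≤ 1).card : ℝ) := by
          rw [Finset.sum_add_distrib, Finset.sum_comm]
          simp only [Finset.sum_boole, Finset.sum_const, Finset.card_univ, Fintype.card_fun,
            Fintype.card_bool, Fintype.card_fin, nsmul_eq_mul]
          push_cast
          ring
      _ ≤ (24 * m + 14) * 2 ^ (m + 1) + ∑ j ∈ Finset.range (N + 1),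
          (smallBound A j + smallBound A (N - j)) * 2 ^ (m + 1) := by
          gcongr with j hj
          exact card_small_at_extremum_le (by omega) (Finset.mem_range_succ_iff.1 hj)
      _ = (24 * m + 14 + 2 * Q) * 2 ^ (m + 1) := by
          rw [← Finset.sum_mul, Finset.sum_add_distrib, Finset.sum_flip]
          ring
  rw [div_le_iff₀ hpow]
  refine hmain.trans (mul_le_mul_of_nonneg_right ?_ hpow.le)
  set J := ⌊(N : ℝ) / √m⌋₊ with hJ
  have hJle : (J : ℝ) ≤ N / √m := Nat.floor_le (by positivity)
  have hJN : J ≤ N := by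
    have : (J : ℝ) ≤ N := hJle.trans (div_le_self hN0.le hsq.le)
    exact_mod_cast this
  have hQle : Q ≤ 1 + J + A * (1 + log N - log (J + 1)) := sum_smallBound_le hA0 hJN
  have hlogm : 1 ≤ 2 * log m := by
    have h1 := log_le_log two_pos hm'
    have h2 := log_two_gt_d9
    linarith
  have hlog : log N - log (J + 1) ≤ log m / 2 := by
    have h1 : log (N / √m) ≤ log (J + 1) :=
      log_le_log (by positivity) (Nat.lt_floor_add_one _).le
    rw [log_div hN0.ne' hsq0.ne', log_sqrt (by linarith)] at h1
    linarith
  set R : ℝ := n / √m with hR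
  have hR0 : 0 ≤ R := by positivity
  have hNR : N / √m ≤ 3 * R := by
    rw [hR, ← mul_div_assoc]
    gcongr
  have hAR : A ≤ 27 / 2 * R := by
    have : A = 9 / 2 * (N / √m) := by rw [hA]; field_simp
    rw [this]
    linarith
  have hJR : (J : ℝ) ≤ 6 * (R * log m) := by nlinarith
  have hAlog : A * (1 + log N - log (J + 1)) ≤ 27 / 2 * R * (5 / 2 * log m) :=
    (mul_le_mul_of_nonneg_left (by linarith) hA0).trans
      (mul_le_mul_of_nonneg_right hAR (by linarith))
  have hgoal : (n : ℝ) * log m / √m = R * log m := by rw [hR]; ring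
  rw [hgoal]
  have : 0 ≤ R * log m := mul_nonneg hR0 (by linarith)
  linarith
end

section
/- There exist an absolute constant c > 0 and a natural number m_0 such that for all integers n ≥ m ≥ m_0 the following holds: if f(x) = ∑_{k=0}^{n} cos(kx) − ∑_{k=0}^{m} ε_k cos(kx), where ε_0, …, ε_m are independent random variables taking values 0 and 1 each with probability 1/2, then the expected number of zeros of f in [0, 2π] satisfies E Z(f) ≥ c·(n·(log m)/√m + m). -/
open Real MeasureTheory

/-- The Rademacher sign attached to a bit. -/
noncomputable def bitSign (b : Bool) : ℝ := if b then 1 else -1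

/-- The Rademacher sum with coefficients `a`. -/
noncomputable def radSum {ι : Type*} [Fintype ι] (a : ι → ℝ) (e : ι → Bool) : ℝ :=
  ∑ k, bitSign (e k) * a k

lemma sum_bits_succ {N : ℕ} (g : (Fin (N + 1) → Bool) → ℝ) :
    ∑ e, g e = ∑ e : Fin N → Bool, (g (Fin.cons true e) + g (Fin.cons false e)) := by
  rw [← (Fin.consEquiv (fun _ : Fin (N + 1) => Bool)).sum_comp, Fintype.sum_prod_type]
  simp [Fin.consEquiv, Finset.sum_add_distrib]

lemma radSum_cons {N : ℕ} (a : Fin (N + 1) → ℝ) (b : Bool) (e : Fin N → Bool) :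
    radSum a (Fin.cons b e : Fin (N + 1) → Bool) =
      bitSign b * a 0 + radSum (fun k => a k.succ) e := by
  simp [radSum, Fin.sum_univ_succ]

lemma sum_radSum {N : ℕ} (a : Fin N → ℝ) : ∑ e, radSum a e = 0 := by
  induction N with
  | zero => simp [radSum]
  | succ N ih =>
    rw [sum_bits_succ]
    simp only [radSum_cons, bitSign]
    have := ih (fun k => a k.succ)
    simp only [if_true, Bool.false_eq_true, if_false]
    calc _ = ∑ e, 2 * radSum (fun k => a k.succ) e := Finset.sum_congr rfl fun e _ => by ring
      _ = 0 := by rw [← Finset.mul_sum, this, mul_zero]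

lemma sum_radSum_mul {N : ℕ} (a b : Fin N → ℝ) :
    ∑ e, radSum a e * radSum b e = 2 ^ N * ∑ k, a k * b k := by
  induction N with
  | zero => simp [radSum]
  | succ N ih =>
    rw [sum_bits_succ]
    simp only [radSum_cons, bitSign]
    have := ih (fun k => a k.succ) (fun k => b k.succ)
    simp only [if_true, Bool.false_eq_true, if_false]
    calc _ = ∑ e, (2 * (radSum (fun k => a k.succ) e * radSum (fun k => b k.succ) e)
            + 2 * (a 0 * b 0)) := Finset.sum_congr rfl fun e _ => by ring
      _ = _ := by
        rw [Finset.sum_add_distrib, ← Finset.mul_sum, this, Fin.sum_univ_succ]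
        simp
        ring

lemma sum_radSum_sq {N : ℕ} (a : Fin N → ℝ) :
    ∑ e, radSum a e ^ 2 = 2 ^ N * ∑ k, a k ^ 2 := by
  simpa [sq] using sum_radSum_mul a a

lemma sum_radSum_pow_four_le {N : ℕ} (a : Fin N → ℝ) :
    ∑ e, radSum a e ^ 4 ≤ 2 ^ N * (3 * (∑ k, a k ^ 2) ^ 2) := by
  induction N with
  | zero => simp [radSum]
  | succ N ih =>
    rw [sum_bits_succ]
    simp only [radSum_cons, bitSign]
    have h4 := ih (fun k => a k.succ)
    have h2 := sum_radSum_sq (fun k => a (Fin.succ k))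
    simp only [if_true, Bool.false_eq_true, if_false]
    calc _ = ∑ e, (2 * radSum (fun k : Fin N => a k.succ) e ^ 4
              + 12 * a 0 ^ 2 * radSum (fun k => a k.succ) e ^ 2 + 2 * a 0 ^ 4) :=
            Finset.sum_congr rfl fun e _ => by ring
      _ = 2 * ∑ e, radSum (fun k : Fin N => a k.succ) e ^ 4
              + 12 * a 0 ^ 2 * (2 ^ N * ∑ k : Fin N, a k.succ ^ 2) + 2 ^ N * (2 * a 0 ^ 4) := by
        rw [Finset.sum_add_distrib, Finset.sum_add_distrib, ← Finset.mul_sum, ← Finset.mul_sum, h2]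
        simp
      _ ≤ _ := by
        rw [Fin.sum_univ_succ]
        have : 0 ≤ 2 ^ N * (4 * a 0 ^ 4) := by positivity
        rw [pow_succ (2 : ℝ)]
        nlinarith

/-- Chebyshev's inequality for Rademacher sums. -/
lemma card_lt_abs_radSum {N : ℕ} (a : Fin N → ℝ) {s v : ℝ} (hs : 0 < s)
    (hv : ∑ k, a k ^ 2 ≤ v) :
    (({e | s < |radSum a e|} : Finset (Fin N → Bool)).card : ℝ) ≤ 2 ^ N * (v / s ^ 2) := by
  have h : (({e | s < |radSum a e|} : Finset (Fin N → Bool)).card : ℝ) * s ^ 2 ≤ 2 ^ N * v := by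
    calc _ = ∑ e ∈ ({e | s < |radSum a e|} : Finset (Fin N → Bool)), s ^ 2 := by simp
      _ ≤ ∑ e ∈ ({e | s < |radSum a e|} : Finset (Fin N → Bool)), radSum a e ^ 2 := by
        refine Finset.sum_le_sum fun e he => ?_
        rw [← sq_abs (radSum a e)]
        have := (Finset.mem_filter.1 he).2
        gcongr
      _ ≤ ∑ e, radSum a e ^ 2 :=
        Finset.sum_le_sum_of_subset_of_nonneg (Finset.subset_univ _) fun _ _ _ => sq_nonneg _
      _ ≤ _ := by rw [sum_radSum_sq]; gcongr
  rw [← mul_div_assoc, le_div_iff₀ (by positivity)]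
  exact h

lemma radSum_not {ι : Type*} [Fintype ι] (a : ι → ℝ) (e : ι → Bool) :
    radSum a (fun k => !(e k)) = -radSum a e := by
  simp only [radSum, ← Finset.sum_neg_distrib]
  refine Finset.sum_congr rfl fun k _ => ?_
  cases e k <;> simp [bitSign]

/-- Two independent copies of a Rademacher sum with coefficients in `[-1, 1]` nearly cancel with
at least the probability expected from a bounded density. -/
lemma card_abs_radSum_add_le {N : ℕ} (w : Fin N → ℝ) (hw : ∀ i, |w i| ≤ 1) {s : ℝ} (hs : 0 < s)
    (hsN : s ≤ √N) :
    4 ^ N * (9 / 112 * (s / √N)) ≤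
      (({p | |radSum w p.1 + radSum w p.2| ≤ s} :
        Finset ((Fin N → Bool) × (Fin N → Bool))).card : ℝ) := by
  classical
  have hN : 0 < √(N : ℝ) := hs.trans_le hsN
  have hN2 : √(N : ℝ) ^ 2 = N := Real.sq_sqrt (Nat.cast_nonneg N)
  have hcheb : (3 / 4 : ℝ) * 2 ^ N ≤
      (({e | |radSum w e| ≤ 2 * √N} : Finset (Fin N → Bool)).card : ℝ) := by
    have h1 := card_lt_abs_radSum w (s := 2 * √N) (v := N) (by positivity) (by
      calc _ ≤ ∑ k : Fin N, (1 : ℝ) := Finset.sum_le_sum fun k _ => by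
            rw [← sq_abs]; exact pow_le_one₀ (abs_nonneg _) (hw k)
        _ = N := by simp)
    have h2 := Finset.card_filter_add_card_filter_not (s := (Finset.univ : Finset (Fin N → Bool)))
      (fun e => |radSum w e| ≤ 2 * √N)
    simp only [not_le] at h2
    have h3 : ((Finset.univ : Finset (Fin N → Bool)).card : ℝ) = 2 ^ N := by simp
    rw [← h2] at h3
    push_cast at h3
    have h4 : (N : ℝ) / (2 * √N) ^ 2 = 1 / 4 := by
      rw [mul_pow, hN2]; rw [← hN2]; field_simp; norm_num
    rw [h4] at h1
    linarith
  set A : Finset (Fin N → Bool) := {e | |radSum w e| ≤ 2 * √N} with hA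
  set bins : Finset ℤ := Finset.Icc ⌊-(2 * √N) / s⌋ ⌊2 * √N / s⌋ with hbins
  have hmap : ∀ e ∈ A, ⌊radSum w e / s⌋ ∈ bins := by
    intro e he
    have := abs_le.1 (Finset.mem_filter.1 he).2
    rw [hbins, Finset.mem_Icc]
    constructor <;> apply Int.floor_le_floor <;> gcongr <;> linarith
  have hbc : (bins.card : ℝ) ≤ 7 * √N / s := by
    rw [hbins, Int.card_Icc]
    have h0 : ⌊-(2 * √N) / s⌋ ≤ ⌊2 * √N / s⌋ := by
      apply Int.floor_le_floor; gcongr; linarith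
    have h1 : (((⌊2 * √N / s⌋ + 1 - ⌊-(2 * √N) / s⌋).toNat : ℤ) : ℝ) =
        ⌊2 * √N / s⌋ + 1 - ⌊-(2 * √N) / s⌋ := by
      rw [Int.toNat_of_nonneg (by omega)]; push_cast; ring
    rw [← Int.cast_natCast (R := ℝ), h1]
    have h2 := Int.floor_le (2 * √N / s)
    have h3 := Int.lt_floor_add_one (-(2 * √N) / s)
    have h4 : 1 ≤ √N / s := by rwa [one_le_div hs]
    have h5 : -(2 * √N) / s = - 2 * (√N / s) := by ring
    have h6 : 2 * √N / s = 2 * (√N / s) := by ring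
    have h7 : 7 * √N / s = 7 * (√N / s) := by ring
    have h8 := h2.trans_eq h6
    have h9 := h5.symm.trans_lt h3
    rw [h7]
    linarith
  have hsum : A.card = ∑ i ∈ bins, (A.filter fun e => ⌊radSum w e / s⌋ = i).card :=
    Finset.card_eq_sum_card_fiberwise hmap
  have hCS : (A.card : ℝ) ^ 2 ≤
      bins.card * ∑ i ∈ bins, ((A.filter fun e => ⌊radSum w e / s⌋ = i).card : ℝ) ^ 2 := by
    rw [hsum]; push_cast
    exact sq_sum_le_card_mul_sum_sq
  have hpairs : ∑ i ∈ bins, ((A.filter fun e => ⌊radSum w e / s⌋ = i).card : ℝ) ^ 2 ≤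
      (({p | |radSum w p.1 + radSum w p.2| ≤ s} :
        Finset ((Fin N → Bool) × (Fin N → Bool))).card : ℝ) := by
    have h1 : ∑ i ∈ bins, (A.filter fun e => ⌊radSum w e / s⌋ = i).card ^ 2 =
        (bins.biUnion fun i => (A.filter fun e => ⌊radSum w e / s⌋ = i) ×ˢ
          (A.filter fun e => ⌊radSum w e / s⌋ = i)).card := by
      rw [Finset.card_biUnion]
      · simp [Finset.card_product, sq]
      · intro i _ j _ hij
        rw [Function.onFun, Finset.disjoint_left]
        rintro p hp hp'
        simp only [Finset.mem_product, Finset.mem_filter] at hp hp'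
        exact hij (hp.1.2.symm.trans hp'.1.2)
    have h2 : (bins.biUnion fun i => (A.filter fun e => ⌊radSum w e / s⌋ = i) ×ˢ
          (A.filter fun e => ⌊radSum w e / s⌋ = i)).card ≤
        ({p | |radSum w p.1 + radSum w p.2| ≤ s} :
          Finset ((Fin N → Bool) × (Fin N → Bool))).card := by
      refine Finset.card_le_card_of_injOn (fun p => (p.1, fun k => !(p.2 k))) ?_ ?_
      · intro p hp
        simp only [Finset.coe_biUnion, Finset.coe_product, Set.mem_iUnion, Set.mem_prod,
          Finset.mem_coe, Finset.mem_filter] at hp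
        obtain ⟨i, _, ⟨_, h1⟩, _, h2⟩ := hp
        simp only [Finset.coe_filter, Finset.mem_univ, true_and, Set.mem_ofPred_eq, radSum_not]
        have := Int.abs_sub_lt_one_of_floor_eq_floor (h1.trans h2.symm)
        rw [← sub_div, abs_div, abs_of_pos hs, div_lt_one hs] at this
        exact this.le
      · rintro ⟨p, q⟩ _ ⟨p', q'⟩ _ h
        simp only [Prod.mk.injEq] at h
        refine Prod.ext h.1 (funext fun k => ?_)
        simpa using congrFun h.2 k
    exact_mod_cast h1.le.trans h2
  refine le_trans ?_ hpairs
  generalize ∑ i ∈ bins, ((A.filter fun e => ⌊radSum w e / s⌋ = i).card : ℝ) ^ 2 = X at hCS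
  have hX : 0 ≤ X := by
    by_contra! h
    have : 0 < (A.card : ℝ) := lt_of_lt_of_le (by positivity) hcheb
    nlinarith [sq_pos_of_pos this, (Nat.cast_nonneg bins.card : (0 : ℝ) ≤ _)]
  have hfin : (3 / 4 * 2 ^ N) ^ 2 ≤ 7 * √N / s * X := by
    calc _ ≤ (A.card : ℝ) ^ 2 := by gcongr
      _ ≤ _ := hCS
      _ ≤ _ := by gcongr
  have h4 : (4 : ℝ) ^ N = (2 ^ N) ^ 2 := by rw [← pow_mul, mul_comm, pow_mul]; norm_num
  rw [h4]
  generalize (2 : ℝ) ^ N = T at *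
  generalize √(N : ℝ) = r at *
  calc _ = (3 / 4 * T) ^ 2 * (s / (7 * r)) := by ring
    _ ≤ 7 * r / s * X * (s / (7 * r)) := by gcongr
    _ = X := by field_simp

lemma sum_comp_embedding {α ι : Type*} [Fintype α] [Fintype ι] [DecidableEq α] [DecidableEq ι]
    (φ : α ↪ ι) (g : (α → Bool) → ℝ) :
    (∑ e : ι → Bool, g (e ∘ φ)) * 2 ^ Fintype.card α = 2 ^ Fintype.card ι * ∑ a, g a := by
  classical
  have hα : Fintype.card {k // k ∈ Set.range φ} = Fintype.card α :=
    (Fintype.card_congr (Equiv.ofInjective φ φ.injective)).symm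
  have hc : Fintype.card ι = Fintype.card α + Fintype.card {k // k ∉ Set.range φ} := by
    rw [← hα, Fintype.card_subtype_compl]
    have := Fintype.card_subtype_le (fun k => k ∈ Set.range φ)
    omega
  have h : ∑ e : ι → Bool, g (e ∘ φ) =
      2 ^ Fintype.card {k // k ∉ Set.range φ} * ∑ a, g a := by
    rw [← (Equiv.piEquivPiSubtypeProd (fun k => k ∈ Set.range φ) (fun _ : ι => Bool)).symm.sum_comp,
      Fintype.sum_prod_type_right]
    have : ∀ y : {k // k ∉ Set.range φ} → Bool, ∑ x : {k // k ∈ Set.range φ} → Bool,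
        g ((Equiv.piEquivPiSubtypeProd (fun k => k ∈ Set.range φ) (fun _ : ι => Bool)).symm (x, y)
          ∘ φ) = ∑ a, g a := by
      intro y
      rw [← ((Equiv.ofInjective φ φ.injective).arrowCongr (Equiv.refl Bool)).sum_comp]
      refine Finset.sum_congr rfl fun a _ => congrArg g (funext fun i => ?_)
      simp [Equiv.piEquivPiSubtypeProd, Equiv.arrowCongr]
    simp [this]
  rw [h, hc, pow_add]
  ring

/-- The number of sign changes along an increasing sequence bounds the number of zeros of an
analytic function from below. -/
lemma sum_signChange_le_zeros {f : ℝ → ℝ} (hf : AnalyticOnNhd ℝ f Set.univ) {x : ℕ → ℝ}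
    (hx : StrictMono x) {a b : ℕ} {A B : ℝ} (hA : A ≤ x a) (hB : x b ≤ B) :
    ∑ j ∈ Finset.Ico a b, (if f (x j) * f (x (j + 1)) < 0 then (1 : ℝ) else 0) ≤
      zeros f (Set.Icc A B) := by
  classical
  rw [Finset.sum_boole]
  set G := {j ∈ Finset.Ico a b | f (x j) * f (x (j + 1)) < 0} with hG
  have hz : ∀ j ∈ G, ∃ z ∈ Set.Ioo (x j) (x (j + 1)), f z = 0 := by
    intro j hj
    have hneg := (Finset.mem_filter.1 hj).2
    have hlt : x j < x (j + 1) := hx (Nat.lt_succ_self j)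
    have hcont : ContinuousOn f (Set.Icc (x j) (x (j + 1))) :=
      hf.continuousOn.mono (Set.subset_univ _)
    rcases mul_neg_iff.1 hneg with h | h
    · obtain ⟨z, hz, h0⟩ := intermediate_value_Ioo' hlt.le hcont ⟨h.2, h.1⟩
      exact ⟨z, hz, h0⟩
    · obtain ⟨z, hz, h0⟩ := intermediate_value_Ioo hlt.le hcont ⟨h.1, h.2⟩
      exact ⟨z, hz, h0⟩
  rcases G.eq_empty_or_nonempty with h0 | ⟨i, hi⟩
  · simp [h0]
  choose! z hz hfz using hz
  have hfin : {y ∈ Set.Icc A B | f y = 0}.Finite := by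
    by_contra hinf
    obtain ⟨p, -, hp⟩ := Set.Infinite.exists_accPt_of_subset_isCompact hinf
      (isCompact_Icc (a := A) (b := B)) (Set.sep_subset _ _)
    have hfreq : ∃ᶠ y in nhdsWithin p {p}ᶜ, f y = 0 := by
      rw [accPt_iff_frequently_nhdsNE] at hp
      exact hp.mono fun y hy => hy.2
    have := hf.eqOn_zero_of_preconnected_of_frequently_eq_zero isPreconnected_univ
      (Set.mem_univ p) hfreq
    have h1 := (Finset.mem_filter.1 hi).2
    rw [this (Set.mem_univ (x i))] at h1
    simp at h1
  rw [zeros, Set.ncard_eq_toFinset_card _ hfin]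
  norm_cast
  refine Finset.card_le_card_of_injOn z ?_ ?_
  · intro j hj
    have hab := Finset.mem_Ico.1 (Finset.mem_filter.1 hj).1
    have h1 := hz j hj
    simp only [Set.Finite.coe_toFinset, Set.mem_ofPred_eq, Set.mem_Icc]
    refine ⟨⟨?_, ?_⟩, hfz j hj⟩
    · exact hA.trans ((hx.monotone hab.1).trans h1.1.le)
    · exact h1.2.le.trans ((hx.monotone hab.2).trans hB)
  · have hlt : ∀ j ∈ G, ∀ k ∈ G, j < k → z j < z k := fun j hj k hk hjk =>
      (hz j hj).2.trans_le ((hx.monotone hjk).trans (hz k hk).1.le)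
    intro j hj k hk hjk
    rcases lt_trichotomy j k with h | h | h
    · exact absurd hjk (hlt j hj k hk h).ne
    · exact h
    · exact absurd hjk (hlt k hk j hj h).ne'

lemma F_analyticOnNhd (n m : ℕ) (e : Fin (m + 1) → Bool) :
    AnalyticOnNhd ℝ (F n m e) Set.univ := by
  intro x _
  have h : ∀ k : ℕ, AnalyticAt ℝ (fun x : ℝ => Real.cos (k * x)) x := fun k =>
    Real.analyticAt_cos.comp (analyticAt_const.mul analyticAt_id)
  refine AnalyticAt.sub ?_ ?_
  · exact Finset.analyticAt_fun_sum _ fun k _ => h k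
  · exact Finset.analyticAt_fun_sum _ fun k _ => analyticAt_const.mul (h k)

lemma two_mul_Dker_mul_sin (n : ℕ) (x : ℝ) :
    2 * Dker n x * Real.sin (x / 2) = Real.sin (x / 2) + Real.sin ((n + 1 / 2) * x) := by
  induction n with
  | zero => simp [Dker]; ring_nf
  | succ n ih =>
    have : Dker (n + 1) x = Dker n x + Real.cos ((n + 1 : ℕ) * x) := by
      simp [Dker, Finset.sum_range_succ _ (n + 1)]
    rw [this]
    have h1 : Real.sin (((n + 1 : ℕ) + 1 / 2) * x) - Real.sin ((n + 1 / 2) * x) =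
        2 * Real.cos ((n + 1 : ℕ) * x) * Real.sin (x / 2) := by
      rw [Real.sin_sub_sin]
      push_cast
      rw [show (((n : ℝ) + 1 + 1 / 2) * x - (n + 1 / 2) * x) / 2 = x / 2 by ring,
        show (((n : ℝ) + 1 + 1 / 2) * x + (n + 1 / 2) * x) / 2 = (n + 1) * x by ring]
      ring
    linarith

lemma two_mul_F (n m : ℕ) (e : Fin (m + 1) → Bool) (x : ℝ) :
    2 * F n m e x =
      2 * Dker n x - Dker m x - radSum (fun k : Fin (m + 1) => Real.cos ((k : ℕ) * x)) e := by
  have h1 : Dker m x = ∑ k : Fin (m + 1), Real.cos ((k : ℕ) * x) :=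
    (Fin.sum_univ_eq_sum_range (fun k => Real.cos ((k : ℕ) * x)) (m + 1)).symm
  have h2 : Dker m x + radSum (fun k : Fin (m + 1) => Real.cos ((k : ℕ) * x)) e =
      2 * ∑ k : Fin (m + 1), (if e k then (1 : ℝ) else 0) * Real.cos ((k : ℕ) * x) := by
    rw [h1, radSum, ← Finset.sum_add_distrib, Finset.mul_sum]
    refine Finset.sum_congr rfl fun k _ => ?_
    cases e k <;> simp [bitSign]
    ring
  rw [F, mul_sub]
  linarith

lemma abs_Dker_le {n : ℕ} {x : ℝ} (h1 : 1 ≤ x) (h2 : x ≤ 4) : |Dker n x| ≤ 5 / 2 := by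
  have hsin : 1 / 4 ≤ Real.sin (x / 2) := by
    rcases le_total (x / 2) (π / 2) with h | h
    · have := Real.mul_le_sin (x := x / 2) (by linarith) h
      refine le_trans ?_ this
      rw [div_mul_eq_mul_div, le_div_iff₀ Real.pi_pos]
      linarith [Real.pi_le_four]
    · rw [← Real.sin_pi_sub]
      have := Real.mul_le_sin (x := π - x / 2) (by linarith [Real.pi_gt_three]) (by linarith)
      refine le_trans ?_ this
      rw [div_mul_eq_mul_div, le_div_iff₀ Real.pi_pos]
      linarith [Real.pi_gt_three]
  have h := two_mul_Dker_mul_sin n x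
  have h3 : (2 * Dker n x - 1) * Real.sin (x / 2) = Real.sin ((n + 1 / 2) * x) := by linarith
  have h4 : |2 * Dker n x - 1| * Real.sin (x / 2) ≤ 1 := by
    rw [← abs_of_pos (by linarith : 0 < Real.sin (x / 2)), ← abs_mul, h3]
    exact Real.abs_sin_le_one _
  have h5 : |2 * Dker n x - 1| ≤ 4 := by nlinarith [abs_nonneg (2 * Dker n x - 1)]
  rw [abs_le] at h5 ⊢
  constructor <;> linarith

lemma sum_cos_mul_cos (m : ℕ) (x y : ℝ) :
    ∑ k : Fin (m + 1), Real.cos ((k : ℕ) * x) * Real.cos ((k : ℕ) * y) =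
      (Dker m (y - x) + Dker m (x + y)) / 2 := by
  rw [Dker, Dker, ← Finset.sum_add_distrib, Finset.sum_div,
    Fin.sum_univ_eq_sum_range (fun k => Real.cos ((k : ℕ) * x) * Real.cos ((k : ℕ) * y)) (m + 1)]
  refine Finset.sum_congr rfl fun k _ => ?_
  rw [mul_sub, mul_add, Real.cos_sub, Real.cos_add]
  ring

lemma sum_cos_sq_le (m : ℕ) (x : ℝ) :
    ∑ k : Fin (m + 1), Real.cos ((k : ℕ) * x) ^ 2 ≤ m + 1 := by
  calc _ ≤ ∑ k : Fin (m + 1), (1 : ℝ) := Finset.sum_le_sum fun k _ => Real.cos_sq_le_one _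
    _ = m + 1 := by simp

lemma sum_const_sub_radSum_pow_four_le {m : ℕ} (hm : 2000 ≤ m) {μ : ℝ} (hμ : |μ| ≤ 15 / 2)
    (x : ℝ) :
    ∑ e, (μ - radSum (fun k : Fin (m + 1) => Real.cos ((k : ℕ) * x)) e) ^ 4 ≤
      2 ^ (m + 1) * (32 * (m : ℝ) ^ 2) := by
  have hμ4 : μ ^ 4 ≤ (15 / 2) ^ 4 := by
    rw [← Even.pow_abs (by decide)]; gcongr
  have hm' : (2000 : ℝ) ≤ m := by exact_mod_cast hm
  have h4 := sum_radSum_pow_four_le (fun k : Fin (m + 1) => Real.cos ((k : ℕ) * x))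
  have h0 : (0 : ℝ) ≤ ∑ k : Fin (m + 1), Real.cos ((k : ℕ) * x) ^ 2 :=
    Finset.sum_nonneg fun _ _ => sq_nonneg _
  have h2 := sum_cos_sq_le m x
  calc _ ≤ ∑ e : Fin (m + 1) → Bool, (8 * (15 / 2 : ℝ) ^ 4
        + 8 * radSum (fun k : Fin (m + 1) => Real.cos ((k : ℕ) * x)) e ^ 4) := by
        refine Finset.sum_le_sum fun e _ => ?_
        generalize radSum (fun k : Fin (m + 1) => Real.cos ((k : ℕ) * x)) e = S
        have h1 : (μ - S) ^ 2 ≤ 2 * (μ ^ 2 + S ^ 2) := by nlinarith [sq_nonneg (μ + S)]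
        have h2 : (μ - S) ^ 4 ≤ (2 * (μ ^ 2 + S ^ 2)) ^ 2 := by
          rw [show (μ - S) ^ 4 = ((μ - S) ^ 2) ^ 2 by ring]; gcongr
        nlinarith [sq_nonneg (μ ^ 2 - S ^ 2)]
    _ = 2 ^ (m + 1) * (8 * (15 / 2 : ℝ) ^ 4)
        + 8 * ∑ e, radSum (fun k : Fin (m + 1) => Real.cos ((k : ℕ) * x)) e ^ 4 := by
        rw [Finset.sum_add_distrib, ← Finset.mul_sum]; simp [← Finset.mul_sum]; ring
    _ ≤ 2 ^ (m + 1) * (8 * (15 / 2 : ℝ) ^ 4)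
        + 8 * (2 ^ (m + 1) * (3 * ((m : ℝ) + 1) ^ 2)) := by
        refine add_le_add_right (mul_le_mul_of_nonneg_left (h4.trans ?_) (by norm_num)) _
        gcongr
    _ = 2 ^ (m + 1) * (8 * (15 / 2 : ℝ) ^ 4 + 24 * ((m : ℝ) + 1) ^ 2) := by ring
    _ ≤ _ := by
        gcongr
        nlinarith

/-- At distance `3π / (2m + 1)` two values of the random polynomial are negatively correlated,
hence have opposite signs with probability bounded below. -/
lemma card_signChange_ge {m : ℕ} (n : ℕ) (hm : 2000 ≤ m) {x : ℝ} (hx1 : 1 ≤ x)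
    (hx2 : x + 3 * π / (2 * m + 1) ≤ 2) :
    (2 : ℝ) ^ (m + 1) / 12800 ≤
      (({e | F n m e x * F n m e (x + 3 * π / (2 * m + 1)) < 0} :
        Finset (Fin (m + 1) → Bool)).card : ℝ) := by
  have hm' : (2000 : ℝ) ≤ m := by exact_mod_cast hm
  have hpi := Real.pi_pos
  set u := 3 * π / (2 * m + 1) with hu
  have hu0 : 0 < u := by positivity
  obtain ⟨y, rfl⟩ : ∃ y, y = x + u := ⟨_, rfl⟩
  set y := x + u with hy
  have hμ : ∀ z : ℝ, 1 ≤ z → z ≤ 2 → |2 * Dker n z - Dker m z| ≤ 15 / 2 := by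
    intro z h1 h2
    have h3 := abs_le.1 (abs_Dker_le (n := n) h1 (by linarith))
    have h4 := abs_le.1 (abs_Dker_le (n := m) h1 (by linarith))
    rw [abs_le]
    constructor <;> linarith
  have hμx := hμ x hx1 (by linarith)
  have hμy := hμ y (by linarith) hx2
  have hcos : ∑ k : Fin (m + 1), Real.cos ((k : ℕ) * x) * Real.cos ((k : ℕ) * y) ≤
      3 / 2 - m / 10 := by
    rw [sum_cos_mul_cos]
    have h1 := (abs_le.1 (abs_Dker_le (n := m) (x := x + y) (by linarith) (by linarith))).2
    have h2 := two_mul_Dker_mul_sin m u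
    have h3 : Real.sin ((m + 1 / 2) * u) = -1 := by
      rw [show ((m : ℝ) + 1 / 2) * u = π / 2 + π by rw [hu]; field_simp; ring, Real.sin_add_pi,
        Real.sin_pi_div_two]
    have h4 : Real.sin (u / 2) ≤ u / 2 := Real.sin_le (by positivity)
    have h5 : 0 < Real.sin (u / 2) :=
      Real.sin_pos_of_pos_of_lt_pi (by positivity) (by linarith [Real.pi_gt_three])
    have h6 : m / 5 ≤ 1 / u := by
      rw [hu, one_div_div, le_div_iff₀ (by positivity)]
      nlinarith [Real.pi_lt_d2]
    have h7 : 1 / u ≤ 1 / (2 * Real.sin (u / 2)) := by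
      apply one_div_le_one_div_of_le <;> linarith
    have h8 : Dker m u = 1 / 2 - 1 / (2 * Real.sin (u / 2)) := by
      rw [h3] at h2
      field_simp
      linarith
    rw [hy, add_sub_cancel_left, h8]
    linarith
  have hfx := sum_const_sub_radSum_pow_four_le hm hμx x
  have hfy := sum_const_sub_radSum_pow_four_le hm hμy y
  set μ := 2 * Dker n x - Dker m x
  set ν := 2 * Dker n y - Dker m y
  set X : (Fin (m + 1) → Bool) → ℝ :=
    fun e => μ - radSum (fun k : Fin (m + 1) => Real.cos ((k : ℕ) * x)) e with hX
  set Y : (Fin (m + 1) → Bool) → ℝ :=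
    fun e => ν - radSum (fun k : Fin (m + 1) => Real.cos ((k : ℕ) * y)) e with hY
  have hFX : ∀ e, 2 * F n m e x = X e := fun e => two_mul_F n m e x
  have hFY : ∀ e, 2 * F n m e y = Y e := fun e => two_mul_F n m e y
  have hneg : ∀ e, F n m e x * F n m e y < 0 ↔ X e * Y e < 0 := by
    intro e
    rw [← hFX, ← hFY]
    constructor <;> intro h <;> linarith
  simp only [hneg]
  have hXY : ∑ e, X e * Y e ≤ -(2 ^ (m + 1) * (m / 20 : ℝ)) := by
    have h1 : ∑ e, X e * Y e = 2 ^ (m + 1) * (μ * ν +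
        ∑ k : Fin (m + 1), Real.cos ((k : ℕ) * x) * Real.cos ((k : ℕ) * y)) := by
      have e1 := sum_radSum (fun k : Fin (m + 1) => Real.cos ((k : ℕ) * x))
      have e2 := sum_radSum (fun k : Fin (m + 1) => Real.cos ((k : ℕ) * y))
      have e3 := sum_radSum_mul (fun k : Fin (m + 1) => Real.cos ((k : ℕ) * x))
        (fun k : Fin (m + 1) => Real.cos ((k : ℕ) * y))
      simp only [hX, hY, sub_mul, mul_sub, Finset.sum_sub_distrib, ← Finset.mul_sum,
        ← Finset.sum_mul, e1, e2, e3]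
      simp
      ring
    have h2 : μ * ν ≤ 225 / 4 := by
      calc _ ≤ |μ * ν| := le_abs_self _
        _ = |μ| * |ν| := abs_mul _ _
        _ ≤ 15 / 2 * (15 / 2) := by gcongr
        _ = _ := by norm_num
    rw [h1, ← mul_neg]
    gcongr
    linarith
  have hXY2 : ∑ e, (X e * Y e) ^ 2 ≤ 2 ^ (m + 1) * (32 * (m : ℝ) ^ 2) := by
    calc _ ≤ ∑ e, (X e ^ 4 + Y e ^ 4) / 2 := Finset.sum_le_sum fun e _ => by
          nlinarith [sq_nonneg (X e ^ 2 - Y e ^ 2)]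
      _ = (∑ e, X e ^ 4 + ∑ e, Y e ^ 4) / 2 := by
          rw [← Finset.sum_div, Finset.sum_add_distrib]
      _ ≤ _ := by linarith
  set G : Finset (Fin (m + 1) → Bool) := {e | X e * Y e < 0} with hG
  have hlow : 2 ^ (m + 1) * (m / 20 : ℝ) ≤ ∑ e ∈ G, -(X e * Y e) := by
    have h1 := Finset.sum_filter_add_sum_filter_not Finset.univ (fun e => X e * Y e < 0)
      (fun e => X e * Y e)
    have h2 : 0 ≤ ∑ e with ¬ X e * Y e < 0, X e * Y e :=
      Finset.sum_nonneg fun e he => not_lt.1 (Finset.mem_filter.1 he).2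
    rw [Finset.sum_neg_distrib]
    linarith
  have hCS : (∑ e ∈ G, -(X e * Y e)) ^ 2 ≤ G.card * ∑ e, (X e * Y e) ^ 2 := by
    refine sq_sum_le_card_mul_sum_sq.trans ?_
    simp only [neg_sq]
    gcongr
    exact Finset.subset_univ _
  have hfin : (2 ^ (m + 1) * (m / 20 : ℝ)) ^ 2 ≤ G.card * (2 ^ (m + 1) * (32 * (m : ℝ) ^ 2)) := by
    calc _ ≤ (∑ e ∈ G, -(X e * Y e)) ^ 2 := by gcongr
      _ ≤ _ := hCS
      _ ≤ _ := by gcongr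
  generalize (G.card : ℝ) = g at *
  have hT : (0 : ℝ) < 2 ^ (m + 1) := by positivity
  generalize (2 : ℝ) ^ (m + 1) = T at *
  have hm0 : (0 : ℝ) < m := by linarith
  have h9 : 0 < T * (m : ℝ) ^ 2 := by positivity
  refine le_of_mul_le_mul_right ?_ h9
  nlinarith

/-- The expected number of zeros is at least linear in `m`. -/
lemma linear_le_sum_zeros {m : ℕ} (n : ℕ) (hm : 2000 ≤ m) :
    2 ^ (m + 1) * ((m : ℝ) / 128000) ≤
      ∑ e : Fin (m + 1) → Bool, (zeros (F n m e) (Set.Icc 0 (2 * π)) : ℝ) := by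
  have hm' : (2000 : ℝ) ≤ m := by exact_mod_cast hm
  have hpi := Real.pi_gt_three
  set u := 3 * π / (2 * m + 1) with hu
  have hu0 : 0 < u := by positivity
  set x : ℕ → ℝ := fun j => 1 + j * u with hx
  have hmono : StrictMono x := strictMono_nat_of_lt_succ fun j => by
    simp only [hx]; push_cast; linarith
  set J := ⌊1 / u⌋₊ with hJ
  have hJu : J * u ≤ 1 := by
    rw [← le_div_iff₀ hu0]; exact Nat.floor_le (by positivity)
  have hJm : (m : ℝ) / 10 ≤ J := by
    have h1 : 1 / u < J + 1 := Nat.lt_floor_add_one _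
    have h6 : m / 5 ≤ 1 / u := by
      rw [hu, one_div_div, le_div_iff₀ (by positivity)]
      nlinarith [Real.pi_lt_d2]
    linarith
  have hxJ : x J ≤ 2 := by simp only [hx]; linarith
  calc 2 ^ (m + 1) * ((m : ℝ) / 128000) = m / 10 * (2 ^ (m + 1) / 12800) := by ring
    _ ≤ J * (2 ^ (m + 1) / 12800) := by gcongr
    _ = ∑ j ∈ Finset.Ico 0 J, (2 : ℝ) ^ (m + 1) / 12800 := by simp
    _ ≤ ∑ j ∈ Finset.Ico 0 J, (({e | F n m e (x j) * F n m e (x (j + 1)) < 0} :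
        Finset (Fin (m + 1) → Bool)).card : ℝ) := by
      refine Finset.sum_le_sum fun j hj => ?_
      have h1 : x (j + 1) = x j + 3 * π / (2 * m + 1) := by
        simp only [hx, ← hu]; push_cast; ring
      rw [h1]
      refine card_signChange_ge n hm ?_ ?_
      · simp only [hx]
        have : 0 ≤ j * u := by positivity
        linarith
      · rw [← h1]
        exact (hmono.monotone (Finset.mem_Ico.1 hj).2).trans hxJ
    _ = ∑ e : Fin (m + 1) → Bool, ∑ j ∈ Finset.Ico 0 J,
        (if F n m e (x j) * F n m e (x (j + 1)) < 0 then (1 : ℝ) else 0) := by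
      rw [Finset.sum_comm]
      simp
    _ ≤ _ := by
      refine Finset.sum_le_sum fun e _ => ?_
      refine sum_signChange_le_zeros (F_analyticOnNhd n m e) hmono ?_ ?_
      · simp [hx]
      · linarith

lemma radSum_eq_add_of_embedding {κ ι : Type*} [Fintype κ] [Fintype ι] (φ : κ ⊕ κ ↪ ι)
    {w : κ → ℝ} {W : ι → ℝ} (hl : ∀ i, W (φ (Sum.inl i)) = w i)
    (hr : ∀ i, W (φ (Sum.inr i)) = w i) (h0 : ∀ k ∉ Set.range φ, W k = 0) (e : ι → Bool) :
    radSum W e =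
      radSum w (fun i => e (φ (Sum.inl i))) + radSum w (fun i => e (φ (Sum.inr i))) := by
  unfold radSum
  rw [← Fintype.sum_of_injective φ φ.injective
    (fun s => bitSign (e (φ s)) * W (φ s)) (fun k => bitSign (e k) * W k)
    (fun k hk => by simp [h0 k hk]) (fun _ => rfl), Fintype.sum_sum_type]
  simp [hl, hr]

/-- A Rademacher sum in which the coefficients come in equal pairs is small with at least the
probability expected from a bounded density. -/
lemma card_abs_radSum_le_of_embedding {M N : ℕ} (φ : Fin N ⊕ Fin N ↪ Fin M)
    {w : Fin N → ℝ} {W : Fin M → ℝ} (hl : ∀ i, W (φ (Sum.inl i)) = w i)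
    (hr : ∀ i, W (φ (Sum.inr i)) = w i) (h0 : ∀ k ∉ Set.range φ, W k = 0)
    (hw : ∀ i, |w i| ≤ 1) {s : ℝ} (hs : 0 < s) (hsN : s ≤ √N) :
    2 ^ M * (9 / 112 * (s / √N)) ≤
      (({e | |radSum W e| ≤ s} : Finset (Fin M → Bool)).card : ℝ) := by
  have h1 := card_abs_radSum_add_le w hw hs hsN
  have h2 := sum_comp_embedding φ (fun a : Fin N ⊕ Fin N → Bool =>
    if |radSum w (fun i => a (Sum.inl i)) + radSum w (fun i => a (Sum.inr i))| ≤ s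
      then (1 : ℝ) else 0)
  have h3 : ∑ a : Fin N ⊕ Fin N → Bool,
      (if |radSum w (fun i => a (Sum.inl i)) + radSum w (fun i => a (Sum.inr i))| ≤ s
        then (1 : ℝ) else 0) = (({p | |radSum w p.1 + radSum w p.2| ≤ s} :
        Finset ((Fin N → Bool) × (Fin N → Bool))).card : ℝ) := by
    rw [← Finset.sum_boole,
      ← (Equiv.sumArrowEquivProdArrow (Fin N) (Fin N) Bool).symm.sum_comp]
    rfl
  have h4 : ∑ e : Fin M → Bool, (fun a : Fin N ⊕ Fin N → Bool =>
      if |radSum w (fun i => a (Sum.inl i)) + radSum w (fun i => a (Sum.inr i))| ≤ s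
        then (1 : ℝ) else 0) (e ∘ φ) =
      (({e | |radSum W e| ≤ s} : Finset (Fin M → Bool)).card : ℝ) := by
    rw [← Finset.sum_boole]
    refine Finset.sum_congr rfl fun e _ => ?_
    rw [radSum_eq_add_of_embedding φ hl hr h0 e]
    rfl
  rw [h4, h3] at h2
  have h5 : (2 : ℝ) ^ Fintype.card (Fin N ⊕ Fin N) = 4 ^ N := by
    rw [Fintype.card_sum, Fintype.card_fin, ← two_mul, pow_mul]; norm_num
  rw [h5, Fintype.card_fin] at h2
  refine le_of_mul_le_mul_right ?_ (by positivity : (0 : ℝ) < 4 ^ N)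
  rw [h2, mul_assoc]
  gcongr
  linarith

/-- The embedding pairing the indices `2 i` and `2 i + 1`. -/
def pairEmbedding (m : ℕ) : Fin ((m + 1) / 2) ⊕ Fin ((m + 1) / 2) ↪ Fin (m + 1) where
  toFun := Sum.elim (fun i => ⟨2 * i, by omega⟩) (fun i => ⟨2 * i + 1, by omega⟩)
  inj' := by
    rintro (⟨i, hi⟩ | ⟨i, hi⟩) (⟨j, hj⟩ | ⟨j, hj⟩) h <;> simp at h ⊢ <;> omega

lemma sum_cos_sub_sq_le {m : ℕ} {x y z : ℝ} (hx : 0 ≤ x) (hxz : x ≤ z) (hzy : z ≤ y)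
    (hm : m * (z - x) ≤ y) :
    ∑ k : Fin (m + 1), (Real.cos ((k : ℕ) * z) -
      if (k : ℕ) < 2 * ((m + 1) / 2) then Real.cos ((2 * ((k : ℕ) / 2) : ℕ) * x) else 0) ^ 2 ≤
      4 * (m + 1) * y ^ 2 + 1 := by
  have hpair : ∀ k : ℕ, k ≤ m →
      (Real.cos (k * z) - Real.cos ((2 * (k / 2) : ℕ) * x)) ^ 2 ≤ 4 * y ^ 2 := by
    intro k hk
    have h1 : ((2 * (k / 2) : ℕ) : ℝ) + (k % 2 : ℕ) = k := by exact_mod_cast Nat.div_add_mod k 2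
    have h2 : ((k % 2 : ℕ) : ℝ) ≤ 1 := by
      have : k % 2 ≤ 1 := by omega
      exact_mod_cast this
    have h3 : ((2 * (k / 2) : ℕ) : ℝ) ≤ m := by
      have : 2 * (k / 2) ≤ m := by omega
      exact_mod_cast this
    have h4 : (0 : ℝ) ≤ (2 * (k / 2) : ℕ) := Nat.cast_nonneg _
    have h5 : (0 : ℝ) ≤ (k % 2 : ℕ) := Nat.cast_nonneg _
    rw [← h1]
    generalize ((2 * (k / 2) : ℕ) : ℝ) = q at *
    generalize ((k % 2 : ℕ) : ℝ) = r at *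
    have h6 : |Real.cos ((q + r) * z) - Real.cos (q * x)| ≤ 2 * y := by
      refine (Real.abs_cos_sub_cos_le _ _).trans ?_
      have h7 : q * (z - x) ≤ y := (mul_le_mul_of_nonneg_right h3 (by linarith)).trans hm
      have h8 : r * z ≤ y := by nlinarith
      have h9 : 0 ≤ q * (z - x) := mul_nonneg h4 (by linarith)
      have h10 : 0 ≤ r * z := mul_nonneg h5 (by linarith)
      rw [abs_le]
      constructor <;> linarith
    calc _ = |Real.cos ((q + r) * z) - Real.cos (q * x)| ^ 2 := (sq_abs _).symm
      _ ≤ (2 * y) ^ 2 := by gcongr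
      _ = _ := by ring
  calc _ ≤ ∑ k : Fin (m + 1), (4 * y ^ 2 + if k = Fin.last m then 1 else 0) := by
        refine Finset.sum_le_sum fun k _ => ?_
        have hk := k.2
        have hlast : k = Fin.last m ↔ (k : ℕ) = m := Fin.ext_iff
        simp only [hlast]
        generalize (k : ℕ) = k at *
        split_ifs with h1 h2 h2
        · exact (hpair k (by omega)).trans (by linarith)
        · exact (hpair k (by omega)).trans (by linarith)
        · rw [sub_zero]
          have := Real.cos_sq_le_one (k * z)
          have := sq_nonneg y
          linarith
        · omega
    _ = _ := by
        rw [Finset.sum_add_distrib]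
        simp
        ring

/-- For nearby `x ≤ y`, both values of the Rademacher cosine sum are `O(1 / y)` with probability
at least of order `1 / (y √m)`. -/
lemma card_abs_radSum_cos_le {m : ℕ} (hm1 : 1 ≤ m) {x y : ℝ} (hx : 0 ≤ x) (hxy : x ≤ y)
    (hm : m * (y - x) ≤ y) (hy1 : 1 ≤ √m * y) (hy2 : y ^ 5 * (m * √m) ≤ 1 / 28800) :
    2 ^ (m + 1) * (1 / 100 / (y * √m)) ≤
      (({e | |radSum (fun k : Fin (m + 1) => Real.cos ((k : ℕ) * x)) e| ≤ 1 / (2 * y) ∧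
        |radSum (fun k : Fin (m + 1) => Real.cos ((k : ℕ) * y)) e| ≤ 1 / (2 * y)} :
        Finset (Fin (m + 1) → Bool)).card : ℝ) := by
  classical
  have hm1' : (1 : ℝ) ≤ m := by exact_mod_cast hm1
  have hsm : 0 < √(m : ℝ) := by positivity
  have hsm2 : √(m : ℝ) ^ 2 = m := Real.sq_sqrt (by positivity)
  have hy : 0 < y := by
    by_contra! h
    nlinarith
  set N := (m + 1) / 2 with hN
  have hNm : (N : ℝ) ≤ m := by
    have : N ≤ m := by omega
    exact_mod_cast this
  have hmN : (m : ℝ) ≤ 4 * N := by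
    have : m ≤ 4 * N := by omega
    exact_mod_cast this
  have hsN1 : √(N : ℝ) ≤ √m := Real.sqrt_le_sqrt hNm
  have hsN2 : √(m : ℝ) ≤ 2 * √N := by
    rw [Real.sqrt_le_left (by positivity), mul_pow, Real.sq_sqrt (by positivity)]
    linarith
  set W : Fin (m + 1) → ℝ := fun k =>
    if (k : ℕ) < 2 * N then Real.cos ((2 * ((k : ℕ) / 2) : ℕ) * x) else 0 with hW
  set s := 1 / (4 * y) with hs
  have hs0 : 0 < s := by positivity
  have hmain : 2 ^ (m + 1) * (9 / 112 * (s / √N)) ≤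
      (({e | |radSum W e| ≤ s} : Finset (Fin (m + 1) → Bool)).card : ℝ) := by
    refine card_abs_radSum_le_of_embedding (pairEmbedding m)
      (w := fun i => Real.cos ((2 * (i : ℕ) : ℕ) * x)) ?_ ?_ ?_ ?_ hs0 ?_
    · intro i
      have := i.2
      have h1 : 2 * (i : ℕ) < 2 * N := by omega
      change (if 2 * (i : ℕ) < 2 * N then Real.cos ((2 * ((2 * (i : ℕ)) / 2) : ℕ) * x) else 0) = _
      rw [if_pos h1, show (2 * (i : ℕ)) / 2 = i by omega]
    · intro i
      have := i.2
      have h1 : 2 * (i : ℕ) + 1 < 2 * N := by omega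
      change (if 2 * (i : ℕ) + 1 < 2 * N then Real.cos ((2 * ((2 * (i : ℕ) + 1) / 2) : ℕ) * x) else 0) = _
      rw [if_pos h1, show (2 * (i : ℕ) + 1) / 2 = i by omega]
    · intro k hk
      simp only [hW]
      rw [if_neg]
      intro h
      apply hk
      rcases Nat.even_or_odd' (k : ℕ) with ⟨c, hc | hc⟩
      · exact ⟨Sum.inl ⟨c, by omega⟩, Fin.ext hc.symm⟩
      · exact ⟨Sum.inr ⟨c, by omega⟩, Fin.ext hc.symm⟩
    · exact fun i => Real.abs_cos_le_one _
    · rw [hs, div_le_iff₀ (by positivity)]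
      nlinarith
  have hvar : 4 * ((m : ℝ) + 1) * y ^ 2 + 1 ≤ 9 * m * y ^ 2 := by
    have h1 : 1 ≤ m * y ^ 2 := by
      rw [← hsm2, ← mul_pow]; exact one_le_pow₀ hy1
    nlinarith [sq_nonneg y]
  have hWx := card_lt_abs_radSum (fun k : Fin (m + 1) => Real.cos ((k : ℕ) * x) - W k) hs0
    ((sum_cos_sub_sq_le hx le_rfl hxy (by simpa using hy.le)).trans hvar)
  have hWy := card_lt_abs_radSum (fun k : Fin (m + 1) => Real.cos ((k : ℕ) * y) - W k) hs0
    ((sum_cos_sub_sq_le hx hxy le_rfl hm).trans hvar)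
  have hsub : ∀ (z : ℝ) (e : Fin (m + 1) → Bool),
      radSum (fun k : Fin (m + 1) => Real.cos ((k : ℕ) * z)) e =
        radSum (fun k : Fin (m + 1) => Real.cos ((k : ℕ) * z) - W k) e + radSum W e := by
    intro z e
    simp only [radSum, ← Finset.sum_add_distrib]
    exact Finset.sum_congr rfl fun k _ => by ring
  set A : Finset (Fin (m + 1) → Bool) := {e | |radSum W e| ≤ s}
  set B : Finset (Fin (m + 1) → Bool) :=
    {e | s < |radSum (fun k : Fin (m + 1) => Real.cos ((k : ℕ) * x) - W k) e|}
  set C : Finset (Fin (m + 1) → Bool) :=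
    {e | s < |radSum (fun k : Fin (m + 1) => Real.cos ((k : ℕ) * y) - W k) e|}
  set G : Finset (Fin (m + 1) → Bool) :=
    {e | |radSum (fun k : Fin (m + 1) => Real.cos ((k : ℕ) * x)) e| ≤ 1 / (2 * y) ∧
        |radSum (fun k : Fin (m + 1) => Real.cos ((k : ℕ) * y)) e| ≤ 1 / (2 * y)}
  have h2s : 1 / (2 * y) = s + s := by rw [hs]; field_simp; norm_num
  have hcover : A ⊆ G ∪ (B ∪ C) := by
    intro e he
    have he' : |radSum W e| ≤ s := (Finset.mem_filter.1 he).2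
    by_cases hB : e ∈ B
    · simp [hB]
    by_cases hC : e ∈ C
    · simp [hC]
    simp only [B, C, Finset.mem_filter, Finset.mem_univ, true_and, not_lt] at hB hC
    refine Finset.mem_union_left _ (Finset.mem_filter.2 ⟨Finset.mem_univ _, ?_⟩)
    rw [hsub x, hsub y, h2s]
    exact ⟨(abs_add_le _ _).trans (add_le_add hB he'), (abs_add_le _ _).trans (add_le_add hC he')⟩
  have hcard : (A.card : ℝ) ≤ G.card + (B.card + C.card) := by
    exact_mod_cast (Finset.card_le_card hcover).trans
      ((Finset.card_union_le _ _).trans (add_le_add_right (Finset.card_union_le _ _) _))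
  have hfin : 1 / 100 / (y * √m) ≤
      9 / 112 * (s / √N) - 2 * (9 * m * y ^ 2 / s ^ 2) := by
    have h1 : 9 / 448 / (y * √m) ≤ 9 / 112 * (s / √N) := by
      calc _ = 9 / 112 * (s / √m) := by rw [hs]; field_simp; norm_num
        _ ≤ _ := by
          have : 0 < √(N : ℝ) := by linarith
          gcongr
    have h2 : 2 * (9 * m * y ^ 2 / s ^ 2) ≤ 1 / 100 / (y * √m) := by
      rw [le_div_iff₀ (by positivity)]
      calc _ = 288 * (y ^ 5 * (m * √m)) := by rw [hs]; field_simp; ring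
        _ ≤ _ := by linarith
    have h3 : 9 / 448 / (y * √m) = 9 / 448 * (1 / (y * √m)) := by ring
    have h4 : 1 / 100 / (y * √m) = 1 / 100 * (1 / (y * √m)) := by ring
    have h5 : 0 < 1 / (y * √m) := by positivity
    linarith
  have hT : (0 : ℝ) < 2 ^ (m + 1) := by positivity
  nlinarith [mul_le_mul_of_nonneg_left hfin hT.le]

lemma pos_mul_F_of_sin_eq {n m : ℕ} {e : Fin (m + 1) → Bool} {y z σ : ℝ} (hz : 0 < z)
    (hzy : z ≤ y) (hy : y < 1) (hσ : σ = 1 ∨ σ = -1)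
    (hsin : Real.sin ((n + 1 / 2) * z) = σ)
    (hS : |radSum (fun k : Fin (m + 1) => Real.cos ((k : ℕ) * z)) e| ≤ 1 / (2 * y)) :
    0 < σ * F n m e z := by
  have hF := two_mul_F n m e z
  have hn := two_mul_Dker_mul_sin n z
  have hm := two_mul_Dker_mul_sin m z
  have hy0 : 0 < y := hz.trans_le hzy
  have hs0 : 0 < Real.sin (z / 2) :=
    Real.sin_pos_of_pos_of_lt_pi (by positivity) (by linarith [Real.pi_gt_three])
  have hs1 : Real.sin (z / 2) ≤ y / 2 := (Real.sin_le (by positivity)).trans (by linarith)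
  have hb := abs_le.1 (Real.abs_sin_le_one ((m + 1 / 2) * z))
  rw [hsin] at hn
  generalize Real.sin ((m + 1 / 2) * z) = t at *
  generalize radSum (fun k : Fin (m + 1) => Real.cos ((k : ℕ) * z)) e = S at *
  generalize Real.sin (z / 2) = s at *
  have hT : 1 / y ≤ 1 / (2 * s) := one_div_le_one_div_of_le (by positivity) (by linarith)
  have hy1 : 1 < 1 / y := by rwa [lt_div_iff₀ hy0, one_mul]
  have h2y : 1 / (2 * y) = 1 / y / 2 := by field_simp
  have hDn : 2 * Dker n z = 1 + 2 * σ * (1 / (2 * s)) := by field_simp; linarith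
  have hDm : Dker m z = 1 / 2 + t * (1 / (2 * s)) := by field_simp; linarith
  rw [hDn, hDm] at hF
  rw [h2y] at hS
  have hS' := abs_le.1 hS
  generalize 1 / (2 * s) = T at *
  generalize 1 / y = Y at *
  have hT0 : 0 < T := by linarith
  rcases hσ with rfl | rfl
  · nlinarith [mul_le_mul_of_nonneg_right hb.2 hT0.le]
  · nlinarith [mul_le_mul_of_nonneg_right hb.1 hT0.le]

lemma sin_mul_extremal (n j : ℕ) :
    Real.sin ((n + 1 / 2) * ((j + 1 / 2) * (π / (n + 1 / 2)))) = (-1) ^ j := by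
  have : ((n : ℝ) + 1 / 2) * ((j + 1 / 2) * (π / (n + 1 / 2))) = π / 2 + j * π := by
    field_simp
    ring
  rw [this, Real.sin_add_nat_mul_pi, Real.sin_pi_div_two, mul_one]

lemma log_sub_log_le_sum_Ico {a b : ℕ} (hab : a ≤ b) {c : ℝ} (hc : 0 < c) :
    Real.log (b + c) - Real.log (a + c) ≤ ∑ j ∈ Finset.Ico a b, 1 / ((j : ℝ) + c) := by
  rw [← Finset.sum_Ico_sub (fun j : ℕ => Real.log (j + c)) hab]
  refine Finset.sum_le_sum fun j _ => ?_
  have hj : 0 < (j : ℝ) + c := by positivity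
  rw [← Real.log_div (by positivity) hj.ne']
  refine (Real.log_le_sub_one_of_pos (by positivity)).trans (le_of_eq ?_)
  push_cast
  field_simp
  ring

/-- Lower bound for the expected number of zeros in a window `[α, β]` on which the oscillating
Dirichlet-type kernel competes with the random part. -/
lemma log_le_sum_zeros_of_window {m n : ℕ} (hm : 3 ≤ m) {α β : ℝ} (hα : 0 < α)
    (hαβ : 4 * α ≤ β) (hβ : β < 1) (hδ : m * (π / (n + 1 / 2)) ≤ α) (hα1 : 1 ≤ √m * α)
    (hβ1 : β ^ 5 * (m * √m) ≤ 1 / 28800) :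
    2 ^ (m + 1) * (n * Real.log (β / (2 * α)) / (400 * √m)) ≤
      ∑ e : Fin (m + 1) → Bool, (zeros (F n m e) (Set.Icc 0 (2 * π)) : ℝ) := by
  have hm' : (3 : ℝ) ≤ m := by exact_mod_cast hm
  have hpi := Real.pi_gt_three
  have hsm : 0 < √(m : ℝ) := by positivity
  have hβ0 : 0 < β := by linarith
  set δ := π / ((n : ℝ) + 1 / 2) with hδdef
  have hδ0 : 0 < δ := by positivity
  have hαδ : 3 ≤ α / δ := by rw [le_div_iff₀ hδ0]; nlinarith
  have hβδ : 4 * (α / δ) ≤ β / δ := by rw [← mul_div_assoc]; gcongr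
  set x : ℕ → ℝ := fun j => (j + 1 / 2) * δ with hx
  have hxs : ∀ j, x (j + 1) = x j + δ := fun j => by simp only [hx]; push_cast; ring
  have hmono : StrictMono x := strictMono_nat_of_lt_succ fun j => by rw [hxs]; linarith
  set a := ⌈α / δ⌉₊
  set b := ⌊β / δ - 1 / 2⌋₊
  have ha1 : α / δ ≤ a := Nat.le_ceil _
  have ha2 : (a : ℝ) < α / δ + 1 := Nat.ceil_lt_add_one (by positivity)
  have hb1 : (b : ℝ) ≤ β / δ - 1 / 2 := Nat.floor_le (by linarith)
  have hb2 : β / δ - 1 / 2 < b + 1 := Nat.lt_floor_add_one _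
  have hab : a ≤ b := by
    have : (a : ℝ) ≤ b := by linarith
    exact_mod_cast this
  have hxb : x b ≤ β := by
    simp only [hx]
    rw [← le_div_iff₀ hδ0]
    linarith
  have hxa : α ≤ x a := by
    simp only [hx]
    rw [← div_le_iff₀ hδ0]
    linarith
  have hcard : ∀ j ∈ Finset.Ico a b, (2 : ℝ) ^ (m + 1) * (1 / 100 / (x (j + 1) * √m)) ≤
      (({e | F n m e (x j) * F n m e (x (j + 1)) < 0} :
        Finset (Fin (m + 1) → Bool)).card : ℝ) := by
    intro j hj
    have hj' := Finset.mem_Ico.1 hj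
    have h1 : α ≤ x j := hxa.trans (hmono.monotone hj'.1)
    have h2 : x (j + 1) ≤ β := (hmono.monotone hj'.2).trans hxb
    have h3 : x j ≤ x (j + 1) := hmono.monotone (Nat.le_succ j)
    have h4 : 0 < x (j + 1) := by linarith
    refine (card_abs_radSum_cos_le (x := x j) (y := x (j + 1)) (by omega) (by linarith) h3
      ?_ ?_ ?_).trans ?_
    · rw [hxs, add_sub_cancel_left]
      linarith
    · refine hα1.trans ?_
      gcongr
      linarith
    · refine le_trans ?_ hβ1
      gcongr
    · norm_cast
      refine Finset.card_le_card fun e he => ?_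
      obtain ⟨he1, he2⟩ := (Finset.mem_filter.1 he).2
      refine Finset.mem_filter.2 ⟨Finset.mem_univ _, ?_⟩
      have p1 := pos_mul_F_of_sin_eq (n := n) (by linarith) h3 (by linarith)
        (neg_one_pow_eq_or ℝ j) (sin_mul_extremal n j) he1
      have p2 := pos_mul_F_of_sin_eq (n := n) h4 le_rfl (by linarith)
        (neg_one_pow_eq_or ℝ (j + 1)) (sin_mul_extremal n (j + 1)) he2
      have p3 := mul_pos p1 p2
      have p4 : ((-1 : ℝ) ^ j) * (-1) ^ (j + 1) = -1 := by
        rw [← pow_add, show j + (j + 1) = 2 * j + 1 by ring, pow_succ, pow_mul]; norm_num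
      have p5 : (-1 : ℝ) ^ j * F n m e (x j) * ((-1) ^ (j + 1) * F n m e (x (j + 1))) =
          ((-1 : ℝ) ^ j * (-1) ^ (j + 1)) * (F n m e (x j) * F n m e (x (j + 1))) := by ring
      rw [p5, p4] at p3
      linarith
  have hlog : Real.log (β / (2 * α)) ≤ ∑ j ∈ Finset.Ico a b, 1 / ((j : ℝ) + 3 / 2) := by
    refine le_trans ?_ (log_sub_log_le_sum_Ico hab (by norm_num : (0 : ℝ) < 3 / 2))
    rw [← Real.log_div (by positivity) (by positivity)]
    apply Real.log_le_log (by positivity)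
    calc β / (2 * α) = (β / δ) / (2 * (α / δ)) := by field_simp
      _ ≤ _ := by
        gcongr
        · linarith
        · linarith
  have hn : (n : ℝ) / 4 ≤ 1 / δ := by
    rw [hδdef, one_div_div, div_le_div_iff₀ (by norm_num) Real.pi_pos]
    nlinarith [Real.pi_le_four]
  have hlog0 : 0 ≤ Real.log (β / (2 * α)) := Real.log_nonneg (by
    rw [le_div_iff₀ (by positivity)]; linarith)
  calc 2 ^ (m + 1) * (n * Real.log (β / (2 * α)) / (400 * √m))
      = 2 ^ (m + 1) * (1 / 100 / √m) * ((n : ℝ) / 4 * Real.log (β / (2 * α))) := by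
        field_simp; ring
    _ ≤ 2 ^ (m + 1) * (1 / 100 / √m) *
        (1 / δ * ∑ j ∈ Finset.Ico a b, 1 / ((j : ℝ) + 3 / 2)) := by gcongr
    _ = ∑ j ∈ Finset.Ico a b, (2 : ℝ) ^ (m + 1) * (1 / 100 / (x (j + 1) * √m)) := by
        rw [Finset.mul_sum, Finset.mul_sum]
        refine Finset.sum_congr rfl fun j _ => ?_
        have h1 : x (j + 1) = (j + 3 / 2) * δ := by simp only [hx]; push_cast; ring
        have h2 : 0 < (j : ℝ) + 3 / 2 := by positivity
        rw [h1]
        field_simp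
    _ ≤ ∑ j ∈ Finset.Ico a b, (({e | F n m e (x j) * F n m e (x (j + 1)) < 0} :
        Finset (Fin (m + 1) → Bool)).card : ℝ) := Finset.sum_le_sum hcard
    _ = ∑ e : Fin (m + 1) → Bool, ∑ j ∈ Finset.Ico a b,
        (if F n m e (x j) * F n m e (x (j + 1)) < 0 then (1 : ℝ) else 0) := by
      rw [Finset.sum_comm]
      simp
    _ ≤ _ := by
      refine Finset.sum_le_sum fun e _ => ?_
      exact sum_signChange_le_zeros (F_analyticOnNhd n m e) hmono (by linarith) (by linarith)

/-- In the range of `n` where it dominates `m`, the term `n log m / √m` bounds the expected number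
of zeros from below up to a constant. -/
lemma log_le_sum_zeros {m n : ℕ} (hm : (10 : ℝ) ^ 100 ≤ m)
    (hlog : 4 * Real.log m ≤ (m : ℝ) ^ (1 / 20 : ℝ)) (hn : (m : ℝ) ≤ n * Real.log m / √m) :
    2 ^ (m + 1) * (n * Real.log m / √m / 8000) ≤
      ∑ e : Fin (m + 1) → Bool, (zeros (F n m e) (Set.Icc 0 (2 * π)) : ℝ) := by
  have hm0 : (0 : ℝ) < m := lt_of_lt_of_le (by positivity) hm
  set r := (m : ℝ) ^ (1 / 20 : ℝ) with hr
  have hr20 : r ^ 20 = m := by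
    rw [hr, ← Real.rpow_natCast, ← Real.rpow_mul hm0.le]; norm_num
  have hr0 : 0 < r := by positivity
  have hr5 : 10 ^ 5 ≤ r := by
    by_contra! h
    have : r ^ 20 < (10 ^ 5) ^ 20 := by gcongr
    rw [hr20, ← pow_mul] at this
    exact absurd hm (not_le.2 this)
  have hsq : √(m : ℝ) = r ^ 10 := by
    rw [← hr20, show r ^ 20 = (r ^ 10) ^ 2 by ring, Real.sqrt_sq (by positivity)]
  have hlogr : Real.log m = 20 * Real.log r := by
    rw [← hr20, Real.log_pow]; norm_num
  have h3 : 3 ≤ m := by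
    have : (3 : ℝ) ≤ m := le_trans (by norm_num) hm
    exact_mod_cast this
  have hlog0 : 0 < Real.log r := Real.log_pos (by linarith)
  have hn0 : (0 : ℝ) < n := by
    by_contra! h
    have h0 : (n : ℝ) = 0 := le_antisymm h (Nat.cast_nonneg n)
    rw [h0] at hn
    simp at hn
    linarith
  have hw := log_le_sum_zeros_of_window (n := n) h3 (α := 1 / r ^ 9) (β := 1 / r ^ 7)
    (by positivity)
    (by
      rw [mul_one_div, div_le_div_iff₀ (by positivity) (by positivity),
        show r ^ 9 = r ^ 2 * r ^ 7 by ring, one_mul]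
      gcongr
      nlinarith)
    (by
      rw [div_lt_one (by positivity)]
      exact one_lt_pow₀ (by linarith) (by norm_num))
    (by
      have h1 : (m : ℝ) * r ^ 10 ≤ n * Real.log m := by
        rwa [hsq, le_div_iff₀ (by positivity)] at hn
      have h2 : (m : ℝ) * r ^ 10 * 4 ≤ n * r := by nlinarith
      rw [← mul_div_assoc, div_le_div_iff₀ (by positivity) (by positivity)]
      have h4 : (m : ℝ) * r ^ 9 * 4 ≤ n := by
        refine le_of_mul_le_mul_right ?_ hr0
        linarith [show (m : ℝ) * r ^ 9 * 4 * r = m * r ^ 10 * 4 by ring]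
      have h5 : (m : ℝ) * π * r ^ 9 ≤ m * 4 * r ^ 9 := by
        gcongr
        exact Real.pi_le_four
      linarith)
    (by
      rw [hsq, mul_one_div, le_div_iff₀ (by positivity), one_mul]
      exact pow_le_pow_right₀ (by linarith) (by norm_num))
    (by
      rw [hsq, ← hr20]
      have : (1 / r ^ 7) ^ 5 * (r ^ 20 * r ^ 10) = 1 / r ^ 5 := by field_simp
      rw [this]
      apply one_div_le_one_div_of_le (by norm_num)
      calc (28800 : ℝ) ≤ r := by linarith
        _ ≤ r ^ 5 := le_self_pow₀ (by linarith) (by norm_num))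
  refine le_trans ?_ hw
  have hL : Real.log r ≤ Real.log (1 / r ^ 7 / (2 * (1 / r ^ 9))) := by
    apply Real.log_le_log hr0
    have : 1 / r ^ 7 / (2 * (1 / r ^ 9)) = r ^ 2 / 2 := by field_simp
    rw [this]
    nlinarith
  calc _ = 2 ^ (m + 1) * (n * Real.log r / (400 * √m)) := by
        rw [hlogr]; field_simp; norm_num
    _ ≤ _ := by gcongr

/-- There is an absolute constant `c > 0` and an `m₀ ∈ ℕ` such that for all `n ≥ m ≥ m₀`, if
`f ~ F_{n,m}` then `E Z(f) ≥ c (n log m / √m + m)`, where the expectation is the average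
over all `2^(m+1)` outcomes of the Bernoulli variables. -/
theorem stmt2 :
    ∃ c : ℝ, 0 < c ∧ ∃ m₀ : ℕ, ∀ m n : ℕ, m₀ ≤ m → m ≤ n →
      c * ((n : ℝ) * Real.log m / Real.sqrt m + m) ≤
        (∑ e : Fin (m + 1) → Bool, (zeros (F n m e) (Set.Icc 0 (2 * π)) : ℝ)) / 2 ^ (m + 1) := by
  have hlog : ∀ᶠ m : ℕ in Filter.atTop, 4 * Real.log m ≤ (m : ℝ) ^ (1 / 20 : ℝ) := by
    have h1 := (isLittleO_log_rpow_atTop (r := 1 / 20) (by norm_num)).bound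
      (c := 1 / 4) (by norm_num)
    filter_upwards [tendsto_natCast_atTop_atTop.eventually h1, Filter.eventually_ge_atTop 1]
      with m hm hm1
    have h2 : (1 : ℝ) ≤ m := by exact_mod_cast hm1
    rw [Real.norm_of_nonneg (Real.log_nonneg h2), Real.norm_of_nonneg (by positivity)] at hm
    linarith
  have hbig : ∀ᶠ m : ℕ in Filter.atTop, (10 : ℝ) ^ 100 ≤ m :=
    tendsto_natCast_atTop_atTop.eventually_ge_atTop _
  obtain ⟨m₀, hm₀⟩ := Filter.eventually_atTop.1 (hlog.and hbig)
  refine ⟨1 / 256000, by norm_num, m₀, fun m n hm _ => ?_⟩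
  obtain ⟨hl, hb⟩ := hm₀ m hm
  have h2000 : 2000 ≤ m := by
    have : (2000 : ℝ) ≤ m := le_trans (by norm_num) hb
    exact_mod_cast this
  rw [le_div_iff₀' (by positivity)]
  rcases le_total ((n : ℝ) * Real.log m / √m) m with h | h
  · refine le_trans ?_ (linear_le_sum_zeros n h2000)
    gcongr
    linarith
  · refine le_trans ?_ (log_le_sum_zeros hb hl h)
    gcongr
    linarith [(Nat.cast_nonneg m : (0 : ℝ) ≤ m)]
end

section
/- There exists an absolute constant C > 0 such that the following holds. Let n be a natural number, let α ∈ (0,1), and let f = D_n − g, where g is a {0,1}-cosine polynomial with deg(g) ≤ n^{1−α}. Then for every interval I contained in [C·(α n)^{-1}, π], the number of zeros of f in I satisfies Z_I(f) ≤ C·α^{-1}·(n·|I| + 1), where |I| denotes the length of I. -/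
open Real MeasureTheory

/-- Rolle's theorem for finite sets of zeros. -/
theorem exists_finset_zeros_deriv {f f' : ℝ → ℝ} (hf : ∀ x, HasDerivAt f (f' x) x) {a b : ℝ}
    (s : Finset ℝ) (hs : ∀ x ∈ s, x ∈ Set.Icc a b ∧ f x = 0) :
    ∃ t : Finset ℝ, (∀ x ∈ t, x ∈ Set.Icc a b ∧ f' x = 0) ∧ s.card ≤ t.card + 1 := by
  have rolle : ∀ p : ℝ × ℝ, ∃ z, p.1 ∈ s → p.2 ∈ s → p.1 < p.2 →
      z ∈ Set.Ioo p.1 p.2 ∧ f' z = 0 := by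
    rintro ⟨x, y⟩
    by_cases h : x ∈ s ∧ y ∈ s ∧ x < y
    · obtain ⟨z, hz, hz'⟩ := exists_hasDerivAt_eq_zero h.2.2
        (fun w _ => (hf w).continuousAt.continuousWithinAt)
        ((hs x h.1).2.trans (hs y h.2.1).2.symm) (fun w _ => hf w)
      exact ⟨z, fun _ _ _ => ⟨hz, hz'⟩⟩
    · exact ⟨0, fun h₁ h₂ h₃ => absurd ⟨h₁, h₂, h₃⟩ h⟩
  choose c hc using rolle
  refine ⟨((s ×ˢ s).filter fun p => p.1 < p.2).image c, ?_, ?_⟩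
  · intro z hz
    simp only [Finset.mem_image, Finset.mem_filter, Finset.mem_product] at hz
    obtain ⟨p, ⟨⟨h₁, h₂⟩, h₃⟩, rfl⟩ := hz
    obtain ⟨hm, h0⟩ := hc p h₁ h₂ h₃
    exact ⟨⟨(hs _ h₁).1.1.trans hm.1.le, hm.2.le.trans (hs _ h₂).1.2⟩, h0⟩
  · refine Finset.card_le_of_interleaved fun x hx y hy hxy _ => ?_
    obtain ⟨hm, -⟩ := hc (x, y) hx hy hxy
    refine ⟨c (x, y), Finset.mem_image_of_mem c ?_, hm.1, hm.2⟩
    simp [hx, hy, hxy]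

/-- Iterated form of Rolle's theorem for finite sets of zeros. -/
theorem exists_finset_zeros_iterated_deriv {F : ℕ → ℝ → ℝ}
    (hF : ∀ j x, HasDerivAt (F j) (F (j + 1) x) x) {a b : ℝ}
    (s : Finset ℝ) (hs : ∀ x ∈ s, x ∈ Set.Icc a b ∧ F 0 x = 0) (k : ℕ) :
    ∃ t : Finset ℝ, (∀ x ∈ t, x ∈ Set.Icc a b ∧ F k x = 0) ∧ s.card ≤ t.card + k := by
  induction k with
  | zero => exact ⟨s, hs, le_rfl⟩
  | succ k ih =>
    obtain ⟨t, ht, hst⟩ := ih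
    obtain ⟨u, hu, htu⟩ := exists_finset_zeros_deriv (hF k) t ht
    exact ⟨u, hu, by omega⟩

/-- A `d`-separated finite subset of `[a, b]` has at most `(b - a) / d + 1` elements. -/
theorem card_le_of_separated {a b d : ℝ} (hd : 0 < d) (hab : a ≤ b) (s : Finset ℝ)
    (hs : ∀ x ∈ s, x ∈ Set.Icc a b) (hsep : ∀ x ∈ s, ∀ y ∈ s, x < y → d ≤ y - x) :
    (s.card : ℝ) ≤ (b - a) / d + 1 := by
  have hcard : s.card ≤ (Finset.range (⌊(b - a) / d⌋₊ + 1)).card := by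
    refine Finset.card_le_card_of_injOn (fun x => ⌊(x - a) / d⌋₊) ?_ ?_
    · intro x hx
      have : ⌊(x - a) / d⌋₊ ≤ ⌊(b - a) / d⌋₊ := by
        gcongr
        exact (hs x hx).2
      simp only [Finset.coe_range, Set.mem_Iio]
      omega
    · have key : ∀ x ∈ s, ∀ y ∈ s, ⌊(x - a) / d⌋₊ = ⌊(y - a) / d⌋₊ → ¬ x < y := by
        intro x hx y hy h hxy
        have h₁ : (⌊(x - a) / d⌋₊ : ℝ) ≤ (x - a) / d :=
          Nat.floor_le (div_nonneg (sub_nonneg.2 (hs x hx).1) hd.le)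
        have h₂ := Nat.lt_floor_add_one ((y - a) / d)
        rw [← h] at h₂
        have h₃ : (y - a) / d - (x - a) / d < 1 := by linarith
        rw [← sub_div, div_lt_one hd] at h₃
        linarith [hsep x hx y hy hxy]
      intro x hx y hy h
      exact le_antisymm (not_lt.1 (key y hy x hx h.symm)) (not_lt.1 (key x hx y hy h))
  rw [Finset.card_range] at hcard
  have h₁ : (s.card : ℝ) ≤ (⌊(b - a) / d⌋₊ : ℝ) + 1 := by exact_mod_cast hcard
  linarith [Nat.floor_le (div_nonneg (sub_nonneg.2 hab) hd.le)]

/-- Zeros of a function which is `C¹`-close to a sinusoid of frequency `N` are separated. -/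
theorem separated_zeros_of_close_to_sin {f f' : ℝ → ℝ} (hf : ∀ x, HasDerivAt f (f' x) x)
    {A N φ : ℝ} (hA : 0 < A) (hN : 0 < N)
    (h₀ : ∀ x, |f x - A * sin (N * x + φ)| ≤ A / 4)
    (h₁ : ∀ x, |f' x - A * N * cos (N * x + φ)| ≤ A * N / 4)
    {x y : ℝ} (hxy : x < y) (hx : f x = 0) (hy : f y = 0) : 1 / (3 * N) ≤ y - x := by
  obtain ⟨z, ⟨hxz, hzy⟩, hz⟩ := exists_hasDerivAt_eq_zero hxy
    (fun w _ => (hf w).continuousAt.continuousWithinAt) (hx.trans hy.symm) (fun w _ => hf w)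
  by_contra! hlt
  have hsin : |sin (N * x + φ)| ≤ 1 / 4 := by
    have := h₀ x
    rw [hx, zero_sub, abs_neg, abs_mul, abs_of_pos hA] at this
    exact le_of_mul_le_mul_left (by linarith) hA
  have hcos : |cos (N * z + φ)| ≤ 1 / 4 := by
    have := h₁ z
    rw [hz, zero_sub, abs_neg, abs_mul, abs_of_pos (mul_pos hA hN)] at this
    exact le_of_mul_le_mul_left (by linarith) (mul_pos hA hN)
  have hcos' : 3 / 4 ≤ |cos (N * x + φ)| := by
    refine abs_le_of_sq_le_sq' ?_ (abs_nonneg _) |>.2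
    have h₂ : sin (N * x + φ) ^ 2 ≤ (1 / 4) ^ 2 := sq_le_sq' (abs_le.1 hsin).1 (abs_le.1 hsin).2
    rw [sq_abs]
    nlinarith [sin_sq_add_cos_sq (N * x + φ)]
  have hlip := abs_cos_sub_cos_le (N * x + φ) (N * z + φ)
  have hdist : |N * x + φ - (N * z + φ)| ≤ 1 / 3 := by
    rw [lt_div_iff₀ (by positivity)] at hlt
    rw [abs_le]
    constructor <;> nlinarith
  have := abs_sub_abs_le_abs_sub (cos (N * x + φ)) (cos (N * z + φ))
  linarith

/-- The `j`-th derivative of `x ↦ sin (ω x)`. -/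
noncomputable def sinDeriv (ω : ℝ) (j : ℕ) (x : ℝ) : ℝ := ω ^ j * sin (ω * x + j * (π / 2))

theorem hasDerivAt_sinDeriv (ω : ℝ) (j : ℕ) (x : ℝ) :
    HasDerivAt (sinDeriv ω j) (sinDeriv ω (j + 1) x) x := by
  have h : HasDerivAt (fun x => ω * x + j * (π / 2)) ω x := by
    simpa using ((hasDerivAt_id x).const_mul ω).add_const (j * (π / 2))
  have h' : sinDeriv ω (j + 1) x = ω ^ j * (cos (ω * x + j * (π / 2)) * ω) := by
    rw [sinDeriv, ← sin_add_pi_div_two]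
    push_cast
    ring_nf
  rw [h']
  exact h.sin.const_mul (ω ^ j)

theorem abs_sinDeriv_le {ω R : ℝ} (h : |ω| ≤ R) (j : ℕ) (x : ℝ) : |sinDeriv ω j x| ≤ R ^ j := by
  rw [sinDeriv, abs_mul, abs_pow]
  calc |ω| ^ j * |sin (ω * x + j * (π / 2))| ≤ |ω| ^ j * 1 := by gcongr; exact abs_sin_le_one _
    _ ≤ R ^ j := by rw [mul_one]; gcongr

theorem two_mul_sin_half_mul_cos (k : ℕ) (x : ℝ) :
    2 * sin (x / 2) * cos (k * x) = sin ((k + 1 / 2) * x) - sin ((k - 1 / 2) * x) := by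
  rw [show ((k : ℝ) + 1 / 2) * x = k * x + x / 2 by ring,
    show ((k : ℝ) - 1 / 2) * x = k * x - x / 2 by ring, sin_add, sin_sub]
  ring

theorem two_mul_sin_half_mul_Dker (n : ℕ) (x : ℝ) :
    2 * sin (x / 2) * Dker n x = sin ((n + 1 / 2) * x) + sin (1 / 2 * x) := by
  rw [Dker]
  induction n with
  | zero => simp; ring_nf
  | succ n ih =>
    rw [Finset.sum_range_succ, mul_add, ih, two_mul_sin_half_mul_cos]
    push_cast
    ring_nf

/-- The `j`-th derivative of the low frequency part of `2 sin (x / 2) (D_n x - g x)`. -/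
noncomputable def lowPart (ε : ℕ → ℝ) (n j : ℕ) (x : ℝ) : ℝ :=
  sinDeriv (1 / 2) j x - ∑ k ∈ Finset.range (n + 1),
    ε k * (sinDeriv (k + 1 / 2) j x - sinDeriv (k - 1 / 2) j x)

theorem hasDerivAt_lowPart (ε : ℕ → ℝ) (n j : ℕ) (x : ℝ) :
    HasDerivAt (lowPart ε n j) (lowPart ε n (j + 1) x) x :=
  (hasDerivAt_sinDeriv _ j x).sub <| HasDerivAt.fun_sum fun _ _ =>
    ((hasDerivAt_sinDeriv _ j x).sub (hasDerivAt_sinDeriv _ j x)).const_mul _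

theorem abs_lowPart_le {ε : ℕ → ℝ} (hε : ∀ k, ε k = 0 ∨ ε k = 1) {m : ℝ} (hm : 0 ≤ m)
    (hdeg : ∀ k : ℕ, m < k → ε k = 0) (n j : ℕ) (x : ℝ) :
    |lowPart ε n j x| ≤ (2 * n + 3) * (m + 1 / 2) ^ j := by
  have hterm : ∀ k ∈ Finset.range (n + 1),
      |ε k * (sinDeriv (k + 1 / 2) j x - sinDeriv (k - 1 / 2) j x)| ≤ 2 * (m + 1 / 2) ^ j := by
    intro k _
    rcases hε k with h | h
    · rw [h, zero_mul, abs_zero]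
      positivity
    · have hk : (k : ℝ) ≤ m := by
        by_contra! hlt
        rw [hdeg k hlt] at h
        norm_num at h
      have hk0 : (0 : ℝ) ≤ k := k.cast_nonneg
      rw [h, one_mul, two_mul]
      refine (abs_sub _ _).trans (add_le_add ?_ ?_) <;>
        exact abs_sinDeriv_le (abs_le.2 ⟨by linarith, by linarith⟩) j x
  have hsum := (Finset.abs_sum_le_sum_abs _ _).trans (Finset.sum_le_sum hterm)
  rw [Finset.sum_const, Finset.card_range, nsmul_eq_mul] at hsum
  have hhalf : |sinDeriv (1 / 2) j x| ≤ (m + 1 / 2) ^ j :=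
    abs_sinDeriv_le (abs_le.2 ⟨by linarith, by linarith⟩) j x
  push_cast at hsum
  refine (abs_sub _ _).trans ((add_le_add hhalf hsum).trans_eq ?_)
  ring

/-- Hölder's inequality for sums of two terms. -/
theorem rpow_mul_rpow_add_le {x y u v α : ℝ} (hx : 0 ≤ x) (hy : 0 ≤ y) (hu : 0 ≤ u) (hv : 0 ≤ v)
    (hxy : 0 < x + y) (huv : 0 < u + v) (hα₀ : 0 ≤ α) (hα₁ : α ≤ 1) :
    x ^ (1 - α) * u ^ α + y ^ (1 - α) * v ^ α ≤ (x + y) ^ (1 - α) * (u + v) ^ α := by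
  have h₁ := geom_mean_le_arith_mean2_weighted (sub_nonneg.2 hα₁) hα₀ (div_nonneg hx hxy.le)
    (div_nonneg hu huv.le) (by ring)
  have h₂ := geom_mean_le_arith_mean2_weighted (sub_nonneg.2 hα₁) hα₀ (div_nonneg hy hxy.le)
    (div_nonneg hv huv.le) (by ring)
  rw [div_rpow hx hxy.le, div_rpow hu huv.le] at h₁
  rw [div_rpow hy hxy.le, div_rpow hv huv.le] at h₂
  have hP : 0 < (x + y) ^ (1 - α) := rpow_pos_of_pos hxy _
  have hQ : 0 < (u + v) ^ α := rpow_pos_of_pos huv _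
  rw [← div_le_one (by positivity)]
  calc (x ^ (1 - α) * u ^ α + y ^ (1 - α) * v ^ α) / ((x + y) ^ (1 - α) * (u + v) ^ α)
      = x ^ (1 - α) / (x + y) ^ (1 - α) * (u ^ α / (u + v) ^ α) +
        y ^ (1 - α) / (x + y) ^ (1 - α) * (v ^ α / (u + v) ^ α) := by
        rw [add_div, mul_div_mul_comm, mul_div_mul_comm]
    _ ≤ _ := add_le_add h₁ h₂
    _ = (1 - α) * ((x + y) / (x + y)) + α * ((u + v) / (u + v)) := by ring
    _ = 1 := by rw [div_self hxy.ne', div_self huv.ne']; ring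

theorem rpow_add_half_le {n α : ℝ} (hn : 0 ≤ n) (hα₀ : 0 < α) (hα₁ : α < 1) :
    n ^ (1 - α) + 1 / 2 ≤ (n + 1 / 2) * ((2 * n + 1) / 3) ^ (-α) := by
  have hN : 0 < n + 1 / 2 := by linarith
  have h := rpow_mul_rpow_add_le (y := 1 / 2) (u := 1) (v := 1 / 2) hn (by norm_num) zero_le_one
    (by norm_num) hN (by norm_num) hα₀.le hα₁.le
  rw [one_rpow, mul_one, ← rpow_add (by norm_num), sub_add_cancel, rpow_one] at h
  refine h.trans_eq ?_
  rw [show (2 * n + 1) / 3 = (n + 1 / 2) / (1 + 1 / 2) by ring, rpow_neg (by positivity),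
    div_rpow hN.le (by norm_num), rpow_sub hN, rpow_one, inv_div, div_mul_eq_mul_div,
    mul_div_assoc]

theorem low_frequency_small {n α : ℝ} (hn : 4 ≤ n) (hα₀ : 0 < α) (hα₁ : α < 1) {K : ℕ}
    (hK : 6 ≤ α * K) :
    (2 * n + 3) * (n ^ (1 - α) + 1 / 2) ^ K ≤ (n + 1 / 2) ^ K / 4 := by
  set y := (2 * n + 1) / 3 with hy
  have hy3 : 3 ≤ y := by rw [hy]; linarith
  have hy0 : 0 < y := by linarith
  have hdecay : (y ^ (-α)) ^ K * y ^ 6 ≤ 1 := by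
    rw [← rpow_natCast (y ^ (-α)), ← rpow_mul hy0.le, ← rpow_natCast y, ← rpow_add hy0]
    refine rpow_le_one_of_one_le_of_nonpos (by linarith) ?_
    push_cast
    linarith
  have hpoly : 4 * (2 * n + 3) ≤ y ^ 6 := by
    have h5 : (3 : ℝ) ^ 5 ≤ y ^ 5 := by gcongr
    have h6 : y ^ 6 = y ^ 5 * y := by ring
    have : n = (3 * y - 1) / 2 := by rw [hy]; ring
    nlinarith
  have hpow : (n ^ (1 - α) + 1 / 2) ^ K ≤ (n + 1 / 2) ^ K * (y ^ (-α)) ^ K := by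
    rw [← mul_pow]
    have := rpow_nonneg (show 0 ≤ n by linarith) (1 - α)
    gcongr
    exact rpow_add_half_le (by linarith) hα₀ hα₁
  have hE : 0 ≤ (y ^ (-α)) ^ K := by positivity
  have hM : 0 ≤ (n + 1 / 2) ^ K := by positivity
  calc (2 * n + 3) * (n ^ (1 - α) + 1 / 2) ^ K
      ≤ y ^ 6 / 4 * ((n + 1 / 2) ^ K * (y ^ (-α)) ^ K) := by
        gcongr
        linarith
    _ = (n + 1 / 2) ^ K / 4 * ((y ^ (-α)) ^ K * y ^ 6) := by ring
    _ ≤ (n + 1 / 2) ^ K / 4 * 1 := by gcongr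
    _ = _ := mul_one _

/-- The zero count on finite sets, valid as soon as `n ≥ 4`. -/
theorem card_zeros_le {n : ℕ} (hn : 4 ≤ n) {α : ℝ} (hα₀ : 0 < α) (hα₁ : α < 1)
    {ε : ℕ → ℝ} (hε : ∀ k, ε k = 0 ∨ ε k = 1)
    (hdeg : ∀ k : ℕ, (n : ℝ) ^ (1 - α) < k → ε k = 0) {a b : ℝ} (hab : a ≤ b) (s : Finset ℝ)
    (hs : ∀ x ∈ s, x ∈ Set.Icc a b ∧
      Dker n x - ∑ k ∈ Finset.range (n + 1), ε k * cos (k * x) = 0) :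
    (s.card : ℝ) ≤ 8 * α⁻¹ * (n * (b - a) + 1) := by
  have hn' : (4 : ℝ) ≤ n := by exact_mod_cast hn
  set N : ℝ := n + 1 / 2 with hN
  set K : ℕ := ⌈6 / α⌉₊ with hKdef
  have hK : 6 ≤ α * K := by
    have := Nat.le_ceil (6 / α)
    rw [div_le_iff₀ hα₀] at this
    linarith
  have hNpos : 0 < N := by linarith
  let F : ℕ → ℝ → ℝ := fun j x => sinDeriv N j x + lowPart ε n j x
  have hF : ∀ j x, HasDerivAt (F j) (F (j + 1) x) x := fun j x =>
    (hasDerivAt_sinDeriv N j x).add (hasDerivAt_lowPart ε n j x)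
  have hF0 : ∀ x ∈ s, x ∈ Set.Icc a b ∧ F 0 x = 0 := by
    intro x hx
    refine ⟨(hs x hx).1, ?_⟩
    have h : 2 * sin (x / 2) *
        (Dker n x - ∑ k ∈ Finset.range (n + 1), ε k * cos (k * x)) = F 0 x := by
      rw [mul_sub, two_mul_sin_half_mul_Dker, Finset.mul_sum]
      simp only [F, lowPart, sinDeriv, pow_zero, one_mul, Nat.cast_zero, zero_mul, add_zero,
        ← two_mul_sin_half_mul_cos]
      rw [add_sub_assoc]
      congr 2
      exact Finset.sum_congr rfl fun k _ => by ring
    rw [← h, (hs x hx).2, mul_zero]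
  obtain ⟨t, ht, hst⟩ := exists_finset_zeros_iterated_deriv hF s hF0 K
  have hlow : ∀ j, K ≤ j → ∀ x, |lowPart ε n j x| ≤ N ^ j / 4 := fun j hj x =>
    (abs_lowPart_le hε (rpow_nonneg n.cast_nonneg _) hdeg n j x).trans <|
      low_frequency_small hn' hα₀ hα₁ <| hK.trans <| by gcongr
  have hsep : ∀ x ∈ t, ∀ y ∈ t, x < y → 1 / (3 * N) ≤ y - x := by
    intro x hx y hy hxy
    refine separated_zeros_of_close_to_sin (hF K) (A := N ^ K) (φ := K * (π / 2))
      (by positivity) hNpos (fun w => ?_) (fun w => ?_) hxy (ht x hx).2 (ht y hy).2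
    · simpa [F, sinDeriv] using hlow K le_rfl w
    · have hmain : sinDeriv N (K + 1) w = N ^ K * N * cos (N * w + K * (π / 2)) := by
        rw [sinDeriv, pow_succ, ← sin_add_pi_div_two]
        push_cast
        ring_nf
      have := hlow (K + 1) K.le_succ w
      rw [pow_succ] at this
      simpa [F, hmain] using this
  have hcard := card_le_of_separated (by positivity) hab t (fun x hx => (ht x hx).1) hsep
  have hst' : (s.card : ℝ) ≤ t.card + K := by exact_mod_cast hst
  have hKle : (K : ℝ) ≤ 6 / α + 1 := (Nat.ceil_lt_add_one (by positivity)).le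
  have hinv : 1 ≤ α⁻¹ := (one_le_inv₀ hα₀).2 hα₁.le
  have hdiv : (b - a) / (1 / (3 * N)) = 3 * N * (b - a) := by field_simp
  have hlen : 0 ≤ b - a := sub_nonneg.2 hab
  have hNle : 3 * N * (b - a) ≤ 8 * (n * (b - a)) := by
    rw [← mul_assoc]
    exact mul_le_mul_of_nonneg_right (by linarith) hlen
  have hscale : 8 * (n * (b - a)) ≤ α⁻¹ * (8 * (n * (b - a))) :=
    le_mul_of_one_le_left (by positivity) hinv
  rw [hdiv] at hcard
  rw [div_eq_mul_inv] at hKle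
  linarith

/-- There exists an absolute constant `C > 0` such that the following holds.  If `α ∈ (0,1)`,
`g` is a `{0,1}`-cosine polynomial of degree at most `n^{1-α}` (i.e. all coefficients are
`0` or `1`, and the coefficient of `cos(kx)` vanishes for `k > n^{1-α}`), `f = D_n - g`,
and `I = [a,b] ⊆ [C(αn)⁻¹, π]` is an interval, then
`Z_I(f) ≤ C α⁻¹ (n |I| + 1)`. -/
theorem stmt3 :
    ∃ C : ℝ, 0 < C ∧ ∀ (n : ℕ) (α : ℝ), α ∈ Set.Ioo (0 : ℝ) 1 →
      ∀ ε : ℕ → ℝ, (∀ k, ε k = 0 ∨ ε k = 1) →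
      (∀ k : ℕ, (n : ℝ) ^ ((1 : ℝ) - α) < k → ε k = 0) →
      ∀ a b : ℝ, C / (α * n) ≤ a → a ≤ b → b ≤ π →
      (zeros (fun x => Dker n x - ∑ k ∈ Finset.range (n + 1), ε k * Real.cos (k * x))
          (Set.Icc a b) : ℝ) ≤ C * α⁻¹ * ((n : ℝ) * (b - a) + 1) := by
  refine ⟨10, by norm_num, ?_⟩
  rintro n α ⟨hα₀, hα₁⟩ ε hε hdeg a b ha hab hb
  have hinv : 1 ≤ α⁻¹ := (one_le_inv₀ hα₀).2 hα₁.le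
  have hlen : 0 ≤ b - a := sub_nonneg.2 hab
  set Z := {x ∈ Set.Icc a b |
    Dker n x - ∑ k ∈ Finset.range (n + 1), ε k * Real.cos (k * x) = 0} with hZ
  change (Z.ncard : ℝ) ≤ _
  rcases Z.infinite_or_finite with hinf | hfin
  · rw [hinf.ncard]
    push_cast
    positivity
  rcases Nat.eq_zero_or_pos n with rfl | hn
  · have hle : Z.ncard ≤ 1 := by
      by_cases h : ε 0 = 1
      · have hZI : Z = Set.Icc a b := by
          ext x
          simp [hZ, Dker, h]
        rw [hZI] at hfin ⊢
        have : b ≤ a := not_lt.1 fun hlt => Set.Icc_infinite hlt hfin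
        rw [le_antisymm this hab]
        simp
      · have hempty : Z = ∅ := by
          ext x
          simp [hZ, Dker, (hε 0).resolve_right h]
        simp [hempty]
    have : (Z.ncard : ℝ) ≤ 1 := by exact_mod_cast hle
    simp only [Nat.cast_zero, zero_mul, zero_add, mul_one]
    linarith
  · have hn0 : (0 : ℝ) < n := by exact_mod_cast hn
    have hn4 : 4 ≤ n := by
      have h := ha.trans (hab.trans hb)
      rw [div_le_iff₀ (by positivity)] at h
      have hαn : α * n ≤ n := mul_le_of_le_one_left hn0.le hα₁.le
      have h3 : (3 : ℝ) < n := by nlinarith [Real.pi_lt_d2, Real.pi_pos]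
      exact_mod_cast h3
    have hcard := card_zeros_le hn4 hα₀ hα₁ hε hdeg hab hfin.toFinset fun x hx =>
      hfin.mem_toFinset.1 hx
    rw [← Set.ncard_eq_toFinset_card Z hfin] at hcard
    refine hcard.trans ?_
    gcongr
    norm_num
end
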